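/- There is a bijection between mobiles containing at least one black vertex and pointed planar maps, under which white vertices of the mobile correspond to the non-pointed vertices of the map, black vertices correspond to the faces of the map, the degree of each black vertex equals the valency of the corresponding face, and the number of edges of the mobile equals the number of edges of the map (only the pointed vertex of the map has no counterpart). In particular, for all n, a, and every function f assigning to each positive integer k a multiplicity f(k): the number of mobiles with at least one black vertex having n edges, a white vertices, and exactly f(k) black vertices of degree k for every k, equals the number of pointed planar maps with n edges, a non-pointed vertices, and exactly f(k) faces of valency k for every k. The same equality of counts holds between rooted mobiles with at least one black vertex and rooted vertex-pointed planar maps. -/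

import Mathlib

/-- The number of cycles of the permutation `σ` that meet the predicate `P`
(cycles = orbits, so fixed points count as cycles of length one). -/
noncomputable def cycleCountOn {m : ℕ} (σ : Equiv.Perm (Fin m)) (P : Fin m → Prop) : ℕ :=
  Nat.card (Quot (fun x y : {z : Fin m // P z} => σ.SameCycle x.1 y.1))

/-- The total number of cycles (orbits) of a permutation. -/
noncomputable def cycleCount {m : ℕ} (σ : Equiv.Perm (Fin m)) : ℕ :=
  cycleCountOn σ fun _ => True

/-- The subgroup generated by `σ` and `α` acts transitively on the darts. -/
def IsTransitivePair {m : ℕ} (σ α : Equiv.Perm (Fin m)) : Prop :=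
  ∀ x y : Fin m, ∃ g ∈ Subgroup.closure ({σ, α} : Set (Equiv.Perm (Fin m))), g x = y

/-- The permutation model of a rooted planar map with `n` edges: `α` is a fixed-point-free
involution of the `2n` darts, `⟨σ, α⟩` is transitive, and Euler's relation
`c(σ) − n + c(σα) = 2` holds (vertices = cycles of `σ`, faces = cycles of `σα`). -/
def IsPlanarMap {n : ℕ} (σ α : Equiv.Perm (Fin (2 * n))) : Prop :=
  (∀ x, α (α x) = x) ∧ (∀ x, α x ≠ x) ∧ IsTransitivePair σ α ∧
    cycleCount σ + cycleCount (σ * α) = n + 2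

/-- A mobile, encoded by permutations on its darts (`Fin m`): `σ` gives the
counterclockwise order of darts around each vertex, `α` is an involution whose 2-cycles
are the edges and whose fixed points are the legs, and `col` colors each dart by the
color of its vertex (`true` = black).  Legs are attached to black vertices only, every
edge has at least one black endpoint (edges are black–black or black–white), the
structure is connected, it is a tree (#vertices = #edges + 1, which forces a one-faced
genus-0 embedding), and around each black vertex the number of legs equals the number of
white neighbors. -/
def IsMobile {m : ℕ} (σ α : Equiv.Perm (Fin m)) (col : Fin m → Bool) : Prop :=
  (∀ x, col (σ x) = col x) ∧
  (∀ x, α (α x) = x) ∧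
  (∀ x, α x = x → col x = true) ∧
  (∀ x, α x ≠ x → (col x = true ∨ col (α x) = true)) ∧
  IsTransitivePair σ α ∧
  cycleCount σ = Nat.card {x : Fin m // α x ≠ x} / 2 + 1 ∧
  ∀ v, col v = true →
    Nat.card {x : Fin m // σ.SameCycle v x ∧ α x = x} =
      Nat.card {x : Fin m // σ.SameCycle v x ∧ α x ≠ x ∧ col (α x) = false}

/-- The statistics of a mobile: `n` edges, `a` white vertices, and `f k` black vertices
of degree `k` for every `k` (the degree of a black vertex is the number of darts —
edge-ends and legs — in its `σ`-cycle). -/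
def MobileStats {m : ℕ} (σ α : Equiv.Perm (Fin m)) (col : Fin m → Bool)
    (n a : ℕ) (f : ℕ → ℕ) : Prop :=
  Nat.card {x : Fin m // α x ≠ x} = 2 * n ∧
  cycleCountOn σ (fun x => col x = false) = a ∧
  ∀ k, cycleCountOn σ
    (fun x => col x = true ∧ Function.minimalPeriod σ x = k) = f k

/-- The number of (isomorphism classes of) mobiles with at least one black vertex,
having `n` edges, `a` white vertices and `f k` black vertices of degree `k` for all `k`.
Isomorphism is simultaneous conjugation of `σ` and `α` by a relabeling of the darts,
compatible with the coloring. -/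
noncomputable def mobileCount (n a : ℕ) (f : ℕ → ℕ) : ℕ :=
  ∑ᶠ m : ℕ, Nat.card (Quot (fun
    (X Y : {w : Equiv.Perm (Fin m) × Equiv.Perm (Fin m) × (Fin m → Bool) //
      IsMobile w.1 w.2.1 w.2.2 ∧ (∃ x, w.2.2 x = true) ∧
        MobileStats w.1 w.2.1 w.2.2 n a f}) =>
    ∃ π : Equiv.Perm (Fin m), π * X.1.1 * π⁻¹ = Y.1.1 ∧ π * X.1.2.1 * π⁻¹ = Y.1.2.1 ∧
      ∀ x, X.1.2.2 x = Y.1.2.2 (π x)))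

/-- The number of rooted mobiles (a root edge is distinguished and oriented, i.e. a
non-leg dart is distinguished) with at least one black vertex and given statistics. -/
noncomputable def rootedMobileCount (n a : ℕ) (f : ℕ → ℕ) : ℕ :=
  ∑ᶠ m : ℕ, Nat.card (Quot (fun
    (X Y : {w : (Equiv.Perm (Fin m) × Equiv.Perm (Fin m)) × (Fin m → Bool) × Fin m //
      IsMobile w.1.1 w.1.2 w.2.1 ∧ (∃ x, w.2.1 x = true) ∧ w.1.2 w.2.2 ≠ w.2.2 ∧
        MobileStats w.1.1 w.1.2 w.2.1 n a f}) =>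
    ∃ π : Equiv.Perm (Fin m), π * X.1.1.1 * π⁻¹ = Y.1.1.1 ∧ π * X.1.1.2 * π⁻¹ = Y.1.1.2 ∧
      (∀ x, X.1.2.1 x = Y.1.2.1 (π x)) ∧ π X.1.2.2 = Y.1.2.2))

/-- The statistics of a pointed map `(σ, α)` pointed at the vertex (cycle of `σ`)
containing the dart `p0`: `a` non-pointed vertices, and `f k` faces of valency `k` for
every `k` (faces are cycles of `σα`, the valency is the cycle length). -/
def PointedMapStats {n : ℕ} (σ α : Equiv.Perm (Fin (2 * n))) (p0 : Fin (2 * n))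
    (a : ℕ) (f : ℕ → ℕ) : Prop :=
  cycleCountOn σ (fun x => ¬ σ.SameCycle p0 x) = a ∧
  ∀ k, cycleCountOn (σ * α)
    (fun x => Function.minimalPeriod (σ * α) x = k) = f k

/-- The number of (isomorphism classes of) pointed planar maps with `n` edges,
`a` non-pointed vertices and `f k` faces of valency `k` for all `k`. -/
noncomputable def pointedMapCount (n a : ℕ) (f : ℕ → ℕ) : ℕ :=
  Nat.card (Quot (fun
    (X Y : {w : Equiv.Perm (Fin (2 * n)) × Equiv.Perm (Fin (2 * n)) × Fin (2 * n) //
      IsPlanarMap w.1 w.2.1 ∧ PointedMapStats w.1 w.2.1 w.2.2 a f}) =>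
    ∃ π : Equiv.Perm (Fin (2 * n)), π * X.1.1 * π⁻¹ = Y.1.1 ∧
      π * X.1.2.1 * π⁻¹ = Y.1.2.1 ∧ Y.1.1.SameCycle (π X.1.2.2) Y.1.2.2))

/-- The number of rooted, vertex-pointed planar maps (a dart is distinguished as the
oriented root edge) with `n` edges, `a` non-pointed vertices and `f k` faces of valency
`k` for all `k`. -/
noncomputable def rootedPointedMapCount (n a : ℕ) (f : ℕ → ℕ) : ℕ :=
  Nat.card (Quot (fun
    (X Y : {w : (Equiv.Perm (Fin (2 * n)) × Equiv.Perm (Fin (2 * n))) ×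
        Fin (2 * n) × Fin (2 * n) //
      IsPlanarMap w.1.1 w.1.2 ∧ PointedMapStats w.1.1 w.1.2 w.2.1 a f}) =>
    ∃ π : Equiv.Perm (Fin (2 * n)), π * X.1.1.1 * π⁻¹ = Y.1.1.1 ∧
      π * X.1.1.2 * π⁻¹ = Y.1.1.2 ∧
      Y.1.1.1.SameCycle (π X.1.2.1) Y.1.2.1 ∧ π X.1.2.2 = Y.1.2.2))
namespace BDG
open Equiv Equiv.Perm

/-- closed under both permutations implies everything -/
def Trs {N : ℕ} (σ α : Perm (Fin N)) : Prop :=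
  ∀ P : Fin N → Prop, (∃ x, P x) → (∀ x, P x → P (σ x)) → (∀ x, P x → P (α x)) → ∀ x, P x

lemma pow_closed {X : Type*} {σ : Perm X} {P : X → Prop} (h : ∀ x, P x → P (σ x)) (k : ℕ) :
    ∀ x, P x → P ((σ ^ k) x) := by
  induction k with
  | zero => intro x hx; simpa using hx
  | succ k ih => intro x hx; rw [pow_succ', Perm.mul_apply]; exact h _ (ih _ hx)

lemma sc_closed {X : Type*} [Finite X] {σ : Perm X} {P : X → Prop} (h : ∀ x, P x → P (σ x))
    {x y : X} (hs : σ.SameCycle x y) (hx : P x) : P y := by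
  obtain ⟨k, rfl⟩ := hs.exists_nat_pow_eq
  exact pow_closed h k x hx

lemma sc_step {X : Type*} (σ : Perm X) (x : X) : σ.SameCycle x (σ x) :=
  ⟨1, by simp⟩

lemma closed_iff {X : Type*} [Finite X] {σ : Perm X} {P : X → Prop} (h : ∀ x, P x → P (σ x)) (x : X) :
    P (σ x) ↔ P x :=
  ⟨fun hx => sc_closed h (sc_step σ x).symm hx, h x⟩

lemma inv_of_step {X Y : Type*} [Finite X] {σ : Perm X} {f : X → Y} (h : ∀ x, f (σ x) = f x)
    {x y : X} (hs : σ.SameCycle x y) : f y = f x :=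
  sc_closed (P := fun z => f z = f x) (fun z hz => (h z).trans hz) hs rfl

lemma trs_iff {N : ℕ} (σ α : Perm (Fin N)) : IsTransitivePair σ α ↔ Trs σ α := by
  constructor
  · rintro h P ⟨x, hx⟩ h1 h2 y
    obtain ⟨g, hg, rfl⟩ := h x y
    have : ∀ z, P (g z) ↔ P z := by
      induction hg using Subgroup.closure_induction with
      | mem g hg =>
        rcases hg with rfl | hg
        · exact closed_iff h1
        · rw [Set.mem_singleton_iff] at hg
          subst hg; exact closed_iff h2
      | one => intro z; simp
      | mul a b _ _ ha hb => intro z; rw [Perm.mul_apply, ha, hb]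
      | inv a _ ha => intro z; rw [← ha]; simp
    exact (this x).2 hx
  · intro h x
    refine h (fun y => ∃ g ∈ Subgroup.closure ({σ, α} : Set (Perm (Fin N))), g x = y)
      ⟨x, 1, one_mem _, rfl⟩ ?_ ?_
    · rintro y ⟨g, hg, rfl⟩
      exact ⟨σ * g, mul_mem (Subgroup.subset_closure (by simp)) hg, rfl⟩
    · rintro y ⟨g, hg, rfl⟩
      exact ⟨α * g, mul_mem (Subgroup.subset_closure (by simp)) hg, rfl⟩

lemma Trs.const {N : ℕ} {σ α : Perm (Fin N)} (h : Trs σ α) {Y : Type*} {f : Fin N → Y}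
    (h1 : ∀ x, f (σ x) = f x) (h2 : ∀ x, f (α x) = f x) (x y : Fin N) : f y = f x :=
  h (fun y => f y = f x) ⟨x, rfl⟩ (fun z hz => (h1 z).trans hz) (fun z hz => (h2 z).trans hz) y

/-- If every nonempty closed set contains `p`, then transitive. -/
lemma trs_of {N : ℕ} {σ α : Perm (Fin N)} (p : Fin N)
    (h : ∀ P : Fin N → Prop, (∃ x, P x) → (∀ x, P x → P (σ x)) → (∀ x, P x → P (α x)) → P p) :
    Trs σ α := by
  intro P hP h1 h2 x
  by_contra hx
  exact h (fun y => ¬ P y) ⟨x, hx⟩ (fun y hy => by rwa [closed_iff h1])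
    (fun y hy => by rwa [closed_iff h2]) (h P hP h1 h2)

/-! quotient cardinalities -/

noncomputable def quotEquivCorr {A B : Type*} {rA : A → A → Prop} {rB : B → B → Prop} (C : A → B → Prop)
    (reflA : ∀ a, rA a a) (reflB : ∀ b, rB b b)
    (hA : ∀ a, ∃ b, C a b) (hB : ∀ b, ∃ a, C a b)
    (h : ∀ a b a' b', C a b → C a' b' → (rA a a' ↔ rB b b')) : Quot rA ≃ Quot rB where
  toFun := Quot.lift (fun a => Quot.mk rB (hA a).choose) (fun a a' hr =>
    Quot.sound ((h _ _ _ _ (hA a).choose_spec (hA a').choose_spec).1 hr))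
  invFun := Quot.lift (fun b => Quot.mk rA (hB b).choose) (fun b b' hr =>
    Quot.sound ((h _ _ _ _ (hB b).choose_spec (hB b').choose_spec).2 hr))
  left_inv := by
    rintro ⟨a⟩
    exact Quot.sound ((h _ _ _ _ (hB _).choose_spec (hA a).choose_spec).2 (reflB _))
  right_inv := by
    rintro ⟨b⟩
    exact Quot.sound ((h _ _ _ _ (hA _).choose_spec (hB b).choose_spec).1 (reflA _))

noncomputable def sigmaQuotEquiv {I : Type*} {M : I → Type*} (r : ∀ i, M i → M i → Prop) :
    (Σ i, Quot (r i)) ≃ Quot (fun a b : Σ i, M i => ∃ h : a.1 = b.1, r b.1 (h ▸ a.2) b.2) where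
  toFun p := Quot.lift (fun x => Quot.mk _ ⟨p.1, x⟩) (fun x y hxy => Quot.sound ⟨rfl, hxy⟩) p.2
  invFun := Quot.lift (fun a => ⟨a.1, Quot.mk _ a.2⟩) (by
    rintro ⟨i, x⟩ ⟨j, y⟩ ⟨h, hr⟩
    dsimp only at h
    subst h
    exact congrArg (Sigma.mk i) (Quot.sound hr))
  left_inv := by rintro ⟨i, ⟨x⟩⟩; rfl
  right_inv := by rintro ⟨⟨i, x⟩⟩; rfl

lemma finsum_card_sigma {Q : ℕ → Type*} [Finite (Σ m, Q m)] :
    ∑ᶠ m, Nat.card (Q m) = Nat.card (Σ m, Q m) := by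
  classical
  have hfin : ∀ m, Finite (Q m) := fun m =>
    Finite.of_injective (fun x : Q m => (⟨m, x⟩ : Σ m, Q m)) (fun x y h => by simpa using h)
  have hs : (Set.range (fun p : Σ m, Q m => p.1)).Finite := Set.finite_range _
  rw [finsum_eq_sum_of_support_subset (s := hs.toFinset)]
  · rw [← Finset.sum_coe_sort, ← Nat.card_sigma (β := fun m : hs.toFinset => Q m)]
    refine Nat.card_congr (Equiv.ofBijective (fun p => ⟨p.1.1, p.2⟩) ⟨?_, ?_⟩)
    · rintro ⟨⟨i, hi⟩, x⟩ ⟨⟨j, hj⟩, y⟩ h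
      simp only [Sigma.mk.injEq] at h
      obtain ⟨rfl, h⟩ := h
      simp only [heq_eq_eq] at h
      rw [h]
    · rintro ⟨i, x⟩
      exact ⟨⟨⟨i, by simpa using ⟨x⟩⟩, x⟩, rfl⟩
  · intro m hm
    have hm' : Nat.card (Q m) ≠ 0 := hm
    have : Nonempty (Q m) := by
      by_contra hc
      rw [not_nonempty_iff] at hc
      exact hm' Nat.card_of_isEmpty
    simpa using this

/-- main counting lemma -/
lemma count_corr {M : ℕ → Type*} (r : ∀ m, M m → M m → Prop) {B : Type*} {rB : B → B → Prop}
    [Finite B] (C : ∀ m, M m → B → Prop)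
    (reflA : ∀ m a, r m a a) (reflB : ∀ b, rB b b)
    (hA : ∀ m a, ∃ b, C m a b) (hB : ∀ b, ∃ m a, C m a b)
    (hm : ∀ m a b m' a' b', C m a b → C m' a' b' → rB b b' → m = m')
    (h : ∀ m a b a' b', C m a b → C m a' b' → (r m a a' ↔ rB b b')) :
    ∑ᶠ m, Nat.card (Quot (r m)) = Nat.card (Quot rB) := by
  have e : (Σ m, Quot (r m)) ≃ Quot rB := (sigmaQuotEquiv r).trans
    (quotEquivCorr (fun a b => C a.1 a.2 b) (fun a => ⟨rfl, reflA _ _⟩) reflB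
      (fun a => hA _ _) (fun b => by obtain ⟨m, a, hab⟩ := hB b; exact ⟨⟨m, a⟩, hab⟩) (by
        rintro ⟨m, a⟩ b ⟨m', a'⟩ b' h1 h2
        constructor
        · rintro ⟨hh, hr⟩
          dsimp only at hh
          subst hh
          exact (h _ _ _ _ _ h1 h2).1 hr
        · intro hr
          have := hm _ _ _ _ _ _ h1 h2 hr
          subst this
          exact ⟨rfl, (h _ _ _ _ _ h1 h2).2 hr⟩))
  have : Finite (Σ m, Quot (r m)) := Finite.of_equiv _ e.symm
  rw [finsum_card_sigma, Nat.card_congr e]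

lemma cc_congr {m m' : ℕ} {σ : Perm (Fin m)} {σ' : Perm (Fin m')} {P : Fin m → Prop}
    {P' : Fin m' → Prop} (f : ∀ x, P x → Fin m') (hf : ∀ x hx, P' (f x hx))
    (h : ∀ x hx y hy, σ.SameCycle x y ↔ σ'.SameCycle (f x hx) (f y hy))
    (hs : ∀ y, P' y → ∃ x hx, σ'.SameCycle (f x hx) y) :
    cycleCountOn σ P = cycleCountOn σ' P' := by
  refine Nat.card_congr (quotEquivCorr (fun x y => σ'.SameCycle (f x.1 x.2) y.1)
    (fun _ => SameCycle.refl _ _) (fun _ => SameCycle.refl _ _)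
    (fun a => ⟨⟨f a.1 a.2, hf _ _⟩, SameCycle.refl _ _⟩) (fun b => ?_) ?_)
  · obtain ⟨x, hx, hh⟩ := hs b.1 b.2
    exact ⟨⟨x, hx⟩, hh⟩
  · intro a b a' b' h1 h2
    rw [h a.1 a.2 a'.1 a'.2]
    exact ⟨fun hh => h1.symm.trans (hh.trans h2), fun hh => h1.trans (hh.trans h2.symm)⟩

lemma quot_sc {m : ℕ} {σ : Perm (Fin m)} {P : Fin m → Prop} {x y : {z // P z}}
    (h : Quot.mk (fun x y : {z : Fin m // P z} => σ.SameCycle x.1 y.1) x = Quot.mk _ y) :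
    σ.SameCycle x.1 y.1 := by
  have := Quot.eqvGen_exact h
  rwa [Equivalence.eqvGen_iff (r := fun x y : {z : Fin m // P z} => σ.SameCycle x.1 y.1)
    ⟨fun _ => SameCycle.refl _ _, fun h => SameCycle.symm h, fun h h' => SameCycle.trans h h'⟩] at this

lemma cc_split {m : ℕ} {σ : Perm (Fin m)} {P : Fin m → Prop} (hP : ∀ x, P x → P (σ x)) :
    cycleCountOn σ P + cycleCountOn σ (fun x => ¬ P x) = cycleCount σ := by
  unfold cycleCount
  unfold cycleCountOn
  rw [← Nat.card_sum]
  refine Nat.card_congr (Equiv.ofBijective (Sum.elim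
    (Quot.map (fun x => ⟨x.1, trivial⟩) (fun _ _ h => h))
    (Quot.map (fun x => ⟨x.1, trivial⟩) (fun _ _ h => h))) ⟨?_, ?_⟩)
  · rintro (x | x) (y | y) h <;> obtain ⟨x, rfl⟩ := Quot.exists_rep x <;>
      obtain ⟨y, rfl⟩ := Quot.exists_rep y
    · exact congrArg Sum.inl (Quot.sound (quot_sc (σ := σ) (P := fun _ => True) h))
    · exact absurd (sc_closed hP (quot_sc (σ := σ) (P := fun _ => True) h) x.2) y.2
    · exact absurd (sc_closed hP (quot_sc (σ := σ) (P := fun _ => True) h).symm y.2) x.2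
    · exact congrArg Sum.inr (Quot.sound (quot_sc (σ := σ) (P := fun _ => True) h))
  · rintro ⟨x⟩
    by_cases hx : P x.1
    · exact ⟨Sum.inl (Quot.mk _ ⟨x.1, hx⟩), rfl⟩
    · exact ⟨Sum.inr (Quot.mk _ ⟨x.1, hx⟩), rfl⟩

lemma cc_one {m : ℕ} {σ : Perm (Fin m)} (p : Fin m) :
    cycleCountOn σ (fun x => σ.SameCycle p x) = 1 := by
  unfold cycleCountOn
  rw [Nat.card_eq_one_iff_unique]
  refine ⟨⟨?_⟩, ⟨Quot.mk _ ⟨p, SameCycle.refl _ _⟩⟩⟩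
  rintro ⟨x⟩ ⟨y⟩
  exact Quot.sound (x.2.symm.trans y.2)

lemma cc_invol {m : ℕ} {τ : Perm (Fin m)} {P : Fin m → Prop}
    (h2 : ∀ x, P x → τ (τ x) = x) :
    Nat.card {x // P x} + Nat.card {x // P x ∧ τ x = x} ≤ 2 * cycleCountOn τ P := by
  classical
  have key : ∀ x y : Fin m, P x → τ.SameCycle x y → y = x ∨ y = τ x := by
    intro x y hx hs
    refine sc_closed (P := fun y => y = x ∨ y = τ x) ?_ hs (Or.inl rfl)
    rintro z (rfl | rfl)
    · exact Or.inr rfl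
    · exact Or.inl (h2 _ hx)
  unfold cycleCountOn
  set Q := Quot (fun x y : {z : Fin m // P z} => τ.SameCycle x.1 y.1) with hQ
  have : 2 * Nat.card Q = Nat.card (Q × Bool) := by rw [Nat.card_prod]; simp [mul_comm]
  rw [this, ← Nat.card_sum]
  have hout : ∀ x : {z // P z}, τ.SameCycle (Quot.out (Quot.mk _ x : Q)).1 x.1 := fun x =>
    quot_sc (σ := τ) (P := P) (Quot.out_eq _)
  let g : {x // P x} ⊕ {x // P x ∧ τ x = x} → Q × Bool := Sum.elim
    (fun x => (Quot.mk _ x, decide ((Quot.out (Quot.mk _ x : Q)) = x)))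
    (fun x => (Quot.mk _ ⟨x.1, x.2.1⟩, false))
  refine Nat.card_le_card_of_injective g ?_
  rintro (x | x) (y | y) h
  · simp only [g, Sum.elim_inl, Prod.mk.injEq] at h
    obtain ⟨h1, h3⟩ := h
    rw [h1] at h3
    have ex := hout x
    have ey := hout y
    rw [h1] at ex
    set o := Quot.out (Quot.mk _ y : Q)
    by_cases hy : o = y
    · simp [hy] at h3; rw [h3]
    · simp [hy] at h3
      have h3 : o ≠ x := h3
      rcases key _ _ o.2 ex with e1 | e1
      · exact absurd (Subtype.ext e1.symm) h3
      · rcases key _ _ o.2 ey with e2 | e2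
        · exact absurd (Subtype.ext e2.symm) hy
        · exact congrArg Sum.inl (Subtype.ext (e1.trans e2.symm))
  · simp only [g, Sum.elim_inl, Sum.elim_inr, Prod.mk.injEq, decide_eq_false_iff_not] at h
    obtain ⟨h1, h3⟩ := h
    have e0 := hout x
    have e1 := quot_sc (σ := τ) (P := P) h1
    exfalso
    apply h3
    have a1 : x.1 = y.1 := by
      rcases key _ _ y.2.1 e1.symm with e | e
      · exact e
      · exact e.trans y.2.2
    apply Subtype.ext
    rcases key _ _ x.2 e0.symm with e | e
    · exact e
    · rw [e, a1, y.2.2]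
  · simp only [g, Sum.elim_inl, Sum.elim_inr, Prod.mk.injEq] at h
    obtain ⟨h1, h3⟩ := h
    have h3 := h3.symm
    rw [decide_eq_false_iff_not] at h3
    have e0 := hout y
    have e1 := quot_sc (σ := τ) (P := P) h1.symm
    exfalso
    apply h3
    have a1 : y.1 = x.1 := by
      rcases key _ _ x.2.1 e1.symm with e | e
      · exact e
      · exact e.trans x.2.2
    apply Subtype.ext
    rcases key _ _ y.2 e0.symm with e | e
    · exact e
    · rw [e, a1, x.2.2]
  · simp only [g, Sum.elim_inr, Prod.mk.injEq, and_true] at h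
    have e1 := quot_sc (σ := τ) (P := P) h
    rcases key _ _ x.2.1 e1 with e | e
    · exact congrArg Sum.inr (Subtype.ext e.symm)
    · exact congrArg Sum.inr (Subtype.ext (by rw [e, x.2.2]))

end BDG
set_option linter.all false
namespace BDG
open Equiv Equiv.Perm

lemma app_inv {X : Type*} (σ : Perm X) (x : X) : σ (σ⁻¹ x) = x := by simp
lemma inv_app {X : Type*} (σ : Perm X) (x : X) : σ⁻¹ (σ x) = x := by simp

abbrev QT {N : ℕ} (σ : Perm (Fin N)) : Type :=
  Quot (fun x y : {z : Fin N // True} => σ.SameCycle x.1 y.1)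

def cl {N : ℕ} (σ : Perm (Fin N)) (x : Fin N) : QT σ := Quot.mk _ ⟨x, trivial⟩

lemma cl_step {N : ℕ} (σ : Perm (Fin N)) (x : Fin N) : cl σ (σ x) = cl σ x :=
  Quot.sound (sc_step σ x).symm

lemma tree_decomp {N : ℕ} {φ τ : Perm (Fin N)} (ht : Trs φ τ)
    (hc : N + 1 ≤ cycleCount φ + cycleCount τ) (g : Fin N → ℚ) :
    ∃ a b : Fin N → ℚ, (∀ x, a (φ x) = a x) ∧ (∀ x, b (τ x) = b x) ∧ ∀ x, g x = b x - a x := by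
  classical
  have : Fintype (QT φ) := Fintype.ofFinite _
  have : Fintype (QT τ) := Fintype.ofFinite _
  let Φ : ((QT φ → ℚ) × (QT τ → ℚ)) →ₗ[ℚ] (Fin N → ℚ) :=
    { toFun := fun p x => p.2 (cl τ x) - p.1 (cl φ x)
      map_add' := by intro p q; ext x; simp; ring
      map_smul' := by intro c p; ext x; simp; ring }
  have hker : Module.finrank ℚ (LinearMap.ker Φ) ≤ 1 := by
    have h1 : (((fun _ => 1), (fun _ => 1)) : (QT φ → ℚ) × (QT τ → ℚ)) ∈ LinearMap.ker Φ := by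
      rw [LinearMap.mem_ker]; ext x; simp [Φ]
    refine finrank_le_one (⟨_, h1⟩ : LinearMap.ker Φ) ?_
    rintro ⟨⟨A, B⟩, hw⟩
    rw [LinearMap.mem_ker] at hw
    have hAB : ∀ x, B (cl τ x) = A (cl φ x) := by
      intro x
      have := congrFun hw x
      simp only [Φ, LinearMap.coe_mk, AddHom.coe_mk, Pi.zero_apply] at this
      linarith
    have hconst := ht.const (f := fun x => A (cl φ x)) (fun x => by rw [cl_step])
      (fun x => by rw [← hAB, cl_step, hAB])
    rcases isEmpty_or_nonempty (Fin N) with hE | ⟨⟨x0⟩⟩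
    · refine ⟨0, ?_⟩
      ext q
      · obtain ⟨x, rfl⟩ := Quot.exists_rep q; exact hE.elim x.1
      · obtain ⟨x, rfl⟩ := Quot.exists_rep q; exact hE.elim x.1
    · refine ⟨A (cl φ x0), ?_⟩
      ext q
      · obtain ⟨x, rfl⟩ := Quot.exists_rep q
        simpa [cl] using (hconst x0 x.1).symm
      · obtain ⟨x, rfl⟩ := Quot.exists_rep q
        simpa [cl] using (hconst x0 x.1).symm.trans (hAB x.1).symm
  have hrn := LinearMap.finrank_range_add_finrank_ker Φ
  have hdom : Module.finrank ℚ ((QT φ → ℚ) × (QT τ → ℚ)) = cycleCount φ + cycleCount τ := by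
    rw [Module.finrank_prod, Module.finrank_fintype_fun_eq_card, Module.finrank_fintype_fun_eq_card,
      ← Nat.card_eq_fintype_card, ← Nat.card_eq_fintype_card]
    rfl
  have hle := Submodule.finrank_le (LinearMap.range Φ)
  have hN : Module.finrank ℚ (Fin N → ℚ) = N := by simp
  have htop : LinearMap.range Φ = ⊤ := Submodule.eq_top_of_finrank_eq (by omega)
  have hg : g ∈ LinearMap.range Φ := by rw [htop]; trivial
  obtain ⟨⟨A, B⟩, hp⟩ := hg
  refine ⟨fun x => A (cl φ x), fun x => B (cl τ x), fun x => by simp only [cl_step],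
    fun x => by simp only [cl_step], fun x => ?_⟩
  rw [← hp]; rfl

lemma tree_onecycle {N : ℕ} {φ τ : Perm (Fin N)} (ht : Trs φ τ)
    (hc : N + 1 ≤ cycleCount φ + cycleCount τ) (x y : Fin N) : (φ * τ).SameCycle x y := by
  classical
  let f : Fin N → ℚ := fun z => if (φ * τ).SameCycle x z then 1 else 0
  have hf : ∀ z, f (φ (τ z)) = f z := by
    intro z
    have : (φ * τ).SameCycle x (φ (τ z)) ↔ (φ * τ).SameCycle x z := by
      rw [← Perm.mul_apply, sameCycle_apply_right]
    simp only [f, this]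
  obtain ⟨a, b, ha, hb, hab⟩ := tree_decomp ht hc f
  have hh : ∀ e, b (φ e) - b e = a e - a (τ⁻¹ e) := by
    intro e
    have h1 := hf (τ⁻¹ e)
    rw [hab, hab, app_inv, ha] at h1
    have h2 := hb (τ⁻¹ e)
    rw [app_inv] at h2
    linarith
  obtain ⟨a', b', ha', hb', hab'⟩ := tree_decomp ht hc (fun e => b (φ e) - b e)
  have s1 : ∑ e, (b (φ e) - b e) * b' e = 0 := by
    have : ∑ e, a (τ⁻¹ e) * b' e = ∑ e, a e * b' e := by
      rw [← Equiv.sum_comp τ]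
      refine Finset.sum_congr rfl fun e _ => ?_
      rw [inv_app, hb']
    calc ∑ e, (b (φ e) - b e) * b' e = ∑ e, (a e * b' e - a (τ⁻¹ e) * b' e) :=
          Finset.sum_congr rfl fun e _ => by rw [hh]; ring
      _ = 0 := by rw [Finset.sum_sub_distrib, this, sub_self]
  have s2 : ∑ e, (b (φ e) - b e) * a' e = 0 := by
    have : ∑ e, b (φ e) * a' e = ∑ e, b e * a' e := by
      rw [← Equiv.sum_comp φ (fun e => b e * a' e)]
      exact Finset.sum_congr rfl fun e _ => by rw [ha']
    calc ∑ e, (b (φ e) - b e) * a' e = ∑ e, (b (φ e) * a' e - b e * a' e) :=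
          Finset.sum_congr rfl fun e _ => by ring
      _ = 0 := by rw [Finset.sum_sub_distrib, this, sub_self]
  have s3 : ∑ e, (b (φ e) - b e) * (b (φ e) - b e) = 0 := by
    calc ∑ e, (b (φ e) - b e) * (b (φ e) - b e)
        = ∑ e, ((b (φ e) - b e) * b' e - (b (φ e) - b e) * a' e) :=
          Finset.sum_congr rfl fun e _ => by
            have := hab' e
            rw [← mul_sub, ← this]
      _ = 0 := by rw [Finset.sum_sub_distrib, s1, s2, sub_self]
  have h0 : ∀ e, b (φ e) - b e = 0 := by
    intro e
    have := (Finset.sum_eq_zero_iff_of_nonneg (fun e _ => mul_self_nonneg (b (φ e) - b e))).1 s3 e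
      (Finset.mem_univ _)
    exact mul_self_eq_zero.1 this
  have hbc := ht.const (f := b) (fun e => by linarith [h0 e]) hb
  have hac := ht.const (f := a) ha (fun e => by
    have h1 := hh (τ e)
    rw [inv_app, h0] at h1
    linarith)
  have hxy : f y = f x := by rw [hab, hab, hbc x y, hac x y]
  have hfx : f x = 1 := by simp [f, SameCycle.refl]
  rw [hfx] at hxy
  by_contra hcon
  simp [f, hcon] at hxy

/-- balanced cycles give a potential -/
lemma exists_potential {N : ℕ} {φ : Perm (Fin N)} {s : Fin N → ℤ}
    (hs : ∀ x, s x = -1 ∨ s x = 0 ∨ s x = 1)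
    (hbal : ∀ v, Nat.card {x // φ.SameCycle v x ∧ s x = 1} =
      Nat.card {x // φ.SameCycle v x ∧ s x = -1}) :
    ∃ g : Fin N → ℚ, ∀ x, g (φ x) = g x + s x := by
  classical
  have hsum : ∀ v, ∑ x, (if φ.SameCycle v x then (s x : ℚ) else 0) = 0 := by
    intro v
    have h1 : ∀ x, (if φ.SameCycle v x then (s x : ℚ) else 0) =
        (if φ.SameCycle v x ∧ s x = 1 then (1:ℚ) else 0) -
        (if φ.SameCycle v x ∧ s x = -1 then (1:ℚ) else 0) := by
      intro x
      by_cases hx : φ.SameCycle v x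
      · rcases hs x with h | h | h <;> simp [hx, h]
      · simp [hx]
    rw [Finset.sum_congr rfl fun x _ => h1 x, Finset.sum_sub_distrib, Finset.sum_boole,
      Finset.sum_boole]
    have := hbal v
    rw [Nat.card_eq_fintype_card, Nat.card_eq_fintype_card, Fintype.card_subtype,
      Fintype.card_subtype] at this
    rw [this, sub_self]
  set n := orderOf φ with hn
  have hn0 : 0 < n := orderOf_pos φ
  have hA : ∀ d, ∑ j ∈ Finset.range n, (s ((φ ^ j) d) : ℚ) = 0 := by
    let A : Fin N → ℚ := fun d => ∑ j ∈ Finset.range n, (s ((φ ^ j) d) : ℚ)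
    have hAinv : ∀ d, A (φ d) = A d := by
      intro d
      have h1 : A (φ d) = ∑ j ∈ Finset.range n, (s ((φ ^ (j+1)) d) : ℚ) := by
        refine Finset.sum_congr rfl fun j _ => ?_
        rw [pow_succ, Perm.mul_apply]
      have h2 := Finset.sum_range_succ' (fun j => (s ((φ ^ j) d) : ℚ)) n
      have h3 := Finset.sum_range_succ (fun j => (s ((φ ^ j) d) : ℚ)) n
      have h4 : φ ^ n = 1 := pow_orderOf_eq_one φ
      rw [h4] at h3
      rw [h1]
      simp only [pow_zero] at h2 h3
      show _ = ∑ j ∈ Finset.range n, (s ((φ ^ j) d) : ℚ)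
      linarith
    intro d
    have e1 : ∑ x, (if φ.SameCycle d x then A x else 0) = 0 := by
      have : ∀ x, (if φ.SameCycle d x then A x else 0) =
          ∑ j ∈ Finset.range n, (if φ.SameCycle d ((φ ^ j) x) then (s ((φ ^ j) x) : ℚ) else 0) := by
        intro x
        simp only [sameCycle_pow_right]
        split_ifs
        · rfl
        · simp
      rw [Finset.sum_congr rfl fun x _ => this x, Finset.sum_comm]
      refine Finset.sum_eq_zero fun j _ => ?_
      rw [Equiv.sum_comp (φ ^ j) (fun x => if φ.SameCycle d x then (s x : ℚ) else 0)]
      exact hsum d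
    have e2 : ∀ x, (if φ.SameCycle d x then A x else 0) =
        (if φ.SameCycle d x then (1:ℚ) else 0) * A d := by
      intro x
      split_ifs with h
      · rw [inv_of_step hAinv h, one_mul]
      · simp
    rw [Finset.sum_congr rfl fun x _ => e2 x, ← Finset.sum_mul] at e1
    rcases mul_eq_zero.1 e1 with h | h
    · exfalso
      have := (Finset.sum_eq_zero_iff_of_nonneg (fun x _ => by split_ifs <;> norm_num)).1 h d
        (Finset.mem_univ _)
      simp [SameCycle.refl] at this
    · exact h
  let S : ℕ → Fin N → ℚ := fun k d => ∑ j ∈ Finset.range k, (s ((φ ^ j) d) : ℚ)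
  have hS : ∀ k d, S k (φ d) = S (k+1) d - s d := by
    intro k d
    have h2 := Finset.sum_range_succ' (fun j => (s ((φ ^ j) d) : ℚ)) k
    show ∑ j ∈ Finset.range k, (s ((φ ^ j) (φ d)) : ℚ) =
      ∑ j ∈ Finset.range (k+1), (s ((φ ^ j) d) : ℚ) - s d
    rw [h2]
    simp [pow_succ]
  refine ⟨fun d => -(1 / (n:ℚ)) * ∑ k ∈ Finset.range n, S k d, fun d => ?_⟩
  have h1 : ∑ k ∈ Finset.range n, S k (φ d) = ∑ k ∈ Finset.range n, S k d - n * s d := by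
    rw [Finset.sum_congr rfl fun k _ => hS k d, Finset.sum_sub_distrib]
    have h2 := Finset.sum_range_succ' (fun j => S j d) n
    have h3 := Finset.sum_range_succ (fun j => S j d) n
    have h4 : S n d = 0 := hA d
    have h5 : S 0 d = 0 := by simp [S]
    simp only [Finset.sum_const, Finset.card_range, nsmul_eq_mul]
    linarith
  have hnq : (n:ℚ) ≠ 0 := by exact_mod_cast hn0.ne'
  simp only [h1]
  field_simp
  ring

lemma balanced_of_potential {N : ℕ} {φ : Perm (Fin N)} {s : Fin N → ℤ}
    (hs : ∀ x, s x = -1 ∨ s x = 0 ∨ s x = 1) {g : Fin N → ℤ} (hg : ∀ x, g (φ x) = g x + s x)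
    (v : Fin N) : Nat.card {x // φ.SameCycle v x ∧ s x = 1} =
      Nat.card {x // φ.SameCycle v x ∧ s x = -1} := by
  classical
  have h1 : ∀ x, (if φ.SameCycle v (φ x) then g (φ x) else 0) - (if φ.SameCycle v x then g x else 0) =
        (if φ.SameCycle v x ∧ s x = 1 then (1:ℤ) else 0) -
        (if φ.SameCycle v x ∧ s x = -1 then (1:ℤ) else 0) := by
    intro x
    simp only [sameCycle_apply_right]
    by_cases hx : φ.SameCycle v x
    · rcases hs x with h | h | h <;> simp [hx, h, hg]
    · simp [hx]
  have h2 := Finset.sum_congr (rfl : (Finset.univ : Finset (Fin N)) = _) fun x _ => h1 x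
  rw [Finset.sum_sub_distrib, Finset.sum_sub_distrib,
    Equiv.sum_comp φ (fun x => if φ.SameCycle v x then g x else 0), sub_self, Finset.sum_boole,
    Finset.sum_boole] at h2
  rw [Nat.card_eq_fintype_card, Nat.card_eq_fintype_card, Fintype.card_subtype,
      Fintype.card_subtype]
  push_cast at h2
  omega

lemma card_of_potential {N : ℕ} {φ : Perm (Fin N)} {s : Fin N → ℤ}
    (hs : ∀ x, s x = -1 ∨ s x = 0 ∨ s x = 1) {g : Fin N → ℚ} (hg : ∀ x, g (φ x) = g x + s x) :
    Nat.card {x // s x = 1} = Nat.card {x // s x = -1} := by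
  classical
  have h1 : ∀ x, g (φ x) - g x =
        (if s x = 1 then (1:ℚ) else 0) - (if s x = -1 then (1:ℚ) else 0) := by
    intro x
    rcases hs x with h | h | h <;> simp [h, hg]
  have h2 := Finset.sum_congr (rfl : (Finset.univ : Finset (Fin N)) = _) fun x _ => h1 x
  rw [Finset.sum_sub_distrib, Finset.sum_sub_distrib,
    Equiv.sum_comp φ (fun x => g x), sub_self, Finset.sum_boole,
    Finset.sum_boole] at h2
  rw [Nat.card_eq_fintype_card, Nat.card_eq_fintype_card, Fintype.card_subtype,
      Fintype.card_subtype]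
  have h3 := eq_of_sub_eq_zero h2.symm
  exact_mod_cast h3

/-! first hits -/

inductive First {D : Type*} (f : D → D) (P : D → Prop) : ℕ → D → D → Prop
  | here (d : D) : P d → First f P 0 d d
  | step (k : ℕ) (d w : D) : ¬ P d → First f P k (f d) w → First f P (k+1) d w

variable {D : Type*} {f : D → D} {P P' : D → Prop}

lemma First.prop {k : ℕ} {d w : D} (h : First f P k d w) : P w := by
  induction h with
  | here d h => exact h
  | step k d w _ _ ih => exact ih

lemma First.eq {k : ℕ} {d w : D} (h : First f P k d w) {k' : ℕ} {w' : D}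
    (h' : First f P k' d w') : w = w' := by
  induction h generalizing k' w' with
  | here d h =>
    cases h' with
    | here _ _ => rfl
    | step _ _ _ h1 _ => exact absurd h h1
  | step k d w h1 _ ih =>
    cases h' with
    | here _ h2 => exact absurd h2 h1
    | step _ _ _ _ h3 => exact ih h3

lemma First.cat {k j : ℕ} {a b c : D} (hPP : ∀ x, P x → P' x) (h : First f P' k a b)
    (h' : First f P j b c) : ∃ i, First f P i a c := by
  induction h with
  | here d h => exact ⟨_, h'⟩
  | step k d w h1 _ ih =>
    obtain ⟨i, hi⟩ := ih h'
    exact ⟨_, First.step _ _ _ (fun hp => h1 (hPP _ hp)) hi⟩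

lemma First.split {k j : ℕ} {a b c : D} (hPP : ∀ x, P x → P' x) (h : First f P' k a b)
    (h' : First f P j a c) : ∃ i ≤ j, First f P i b c := by
  induction h generalizing j with
  | here d h => exact ⟨_, le_rfl, h'⟩
  | step k d w h1 _ ih =>
    cases h' with
    | here _ h2 => exact absurd (hPP _ h2) h1
    | step _ _ _ _ h3 =>
      obtain ⟨i, hi, hh⟩ := ih h3
      exact ⟨i, by omega, hh⟩

lemma First.iter {k : ℕ} {a b : D} (h : First f P k a b) :
    f^[k] a = b ∧ ∀ i < k, ¬ P (f^[i] a) := by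
  induction h with
  | here d h => simp
  | step k d w h1 _ ih =>
    refine ⟨by simpa using ih.1, ?_⟩
    rintro (_ | i) hi
    · simpa using h1
    · simpa using ih.2 i (by omega)

lemma First.closed {k : ℕ} {a b : D} {R : D → Prop} (h : First f P k a b)
    (hR : ∀ x, ¬ P x → R x → R (f x)) (ha : R a) : R b := by
  induction h with
  | here d h => exact ha
  | step k d w h1 _ ih => exact ih (hR _ h1 ha)

lemma First.exists' {k : ℕ} {a b : D} (h : f^[k] a = b) (hb : P b) : ∃ i c, First f P i a c := by
  induction k generalizing a with
  | zero => exact ⟨0, a, First.here _ (by simpa [← h] using hb)⟩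
  | succ k ih =>
    by_cases ha : P a
    · exact ⟨0, a, First.here _ ha⟩
    · obtain ⟨i, c, hc⟩ := ih (a := f a) (by simpa using h)
      exact ⟨_, c, First.step _ _ _ ha hc⟩

lemma First.inj (hf : Function.Injective f) {j k : ℕ} {a b c : D} (ha : P a) (hb : P b)
    (h : First f P j (f a) c) (h' : First f P k (f b) c) : a = b := by
  have main : ∀ {j k : ℕ} {a b : D}, P a → First f P j (f a) c → First f P k (f b) c → j ≤ k →
      a = b := by
    intro j k a b ha h h' hjk
    obtain ⟨e1, -⟩ := h.iter
    obtain ⟨e2, n2⟩ := h'.iter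
    obtain ⟨i, rfl⟩ := Nat.exists_eq_add_of_le hjk
    have e3 : f^[j+1] a = f^[j+1] (f^[i] b) := by
      rw [← Function.iterate_add_apply, Function.iterate_succ_apply, e1,
        show j + 1 + i = (j + i) + 1 by ring, Function.iterate_succ_apply, e2]
    have e4 := hf.iterate _ e3
    rcases i with _ | i
    · simpa using e4
    · exfalso
      apply n2 i (by omega)
      rw [← Function.iterate_succ_apply, ← e4]
      exact ha
  rcases le_total j k with hjk | hjk
  · exact main ha h h' hjk
  · exact (main hb h' h hjk).symm

lemma First.sc {D : Type*} {σ : Perm D} {P : D → Prop} {k : ℕ} {a b : D}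
    (h : First σ P k a b) : σ.SameCycle a b :=
  h.closed (R := fun x => σ.SameCycle a x) (fun x _ hx => hx.trans (sc_step σ x))
    (SameCycle.refl _ _)

lemma First.of_sc {D : Type*} [Finite D] {σ : Perm D} {P : D → Prop} {a b : D}
    (h : σ.SameCycle a b) (hb : P b) : ∃ i c, First σ P i a c := by
  obtain ⟨k, hk⟩ := h.exists_nat_pow_eq
  rw [← Perm.iterate_eq_pow] at hk
  exact First.exists' hk hb

end BDG
set_option linter.all false
namespace BDG
open Equiv Equiv.Perm

structure Good {N : ℕ} (φ τ α : Perm (Fin N)) (s ℓ : Fin N → ℤ) (p : Fin N) : Prop where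
  hα : ∀ x, α (α x) = x
  ne : ∀ x, α x ≠ x
  nonneg : ∀ x, 0 ≤ ℓ x
  stepφ : ∀ x, ℓ (φ x) = ℓ x + s x
  hσ : ∀ x, ℓ (φ (α x)) = ℓ x
  s3 : ∀ x, s x = -1 ∨ s x = 0 ∨ s x = 1
  zero : ∀ x, ℓ x = 0 ↔ (φ * α).SameCycle p x
  desc : ∀ x, 0 < ℓ x → ∃ w, (φ * α).SameCycle x w ∧ s w = -1
  τL : ∀ x, s x = 1 → τ x = x
  τB : ∀ x, s x = 0 → τ x = α x
  sτ : ∀ x, s (τ x) = s x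
  next : ∀ w, s w = -1 → ∃ k, First (φ * α) (fun x => s x = -1) k (φ (α (τ w))) w

/-- reduced mobile -/
structure RM {N : ℕ} (φ τ : Perm (Fin N)) (s : Fin N → ℤ) : Prop where
  s3 : ∀ x, s x = -1 ∨ s x = 0 ∨ s x = 1
  τL : ∀ x, s x = 1 → τ x = x
  τB : ∀ x, s x = 0 → τ x ≠ x ∧ τ (τ x) = x
  sτ : ∀ x, s (τ x) = s x
  trs : Trs φ τ
  tree : 2 * (cycleCount φ + cycleCountOn τ (fun x => s x = -1)) = N + 2
  bal : ∀ v, Nat.card {x // φ.SameCycle v x ∧ s x = 1} =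
      Nat.card {x // φ.SameCycle v x ∧ s x = -1}

section
variable {N : ℕ} {φ τ α : Perm (Fin N)} {s ℓ : Fin N → ℤ} {p : Fin N}

lemma Good.lα (G : Good φ τ α s ℓ p) (x : Fin N) : ℓ (α x) = ℓ x + s x := by
  have h1 := G.hσ (α x)
  rw [G.hα, G.stepφ] at h1
  exact h1.symm

lemma Good.sα (G : Good φ τ α s ℓ p) (x : Fin N) : s (α x) = - s x := by
  have h1 := G.lα x
  have h2 := G.lα (α x)
  rw [G.hα] at h2
  linarith

lemma Good.lsc (G : Good φ τ α s ℓ p) {x y : Fin N} (h : (φ * α).SameCycle x y) : ℓ y = ℓ x :=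
  inv_of_step (fun z => G.hσ z) h

lemma Good.lτ (G : Good φ τ α s ℓ p) (x : Fin N) : ℓ (τ x) = ℓ x := by
  rcases G.s3 x with h | h | h
  · obtain ⟨k, hk⟩ := G.next x h
    have h1 := G.lsc hk.sc
    rw [G.hσ] at h1
    exact h1.symm
  · rw [G.τB x h, G.lα, h, add_zero]
  · rw [G.τL x h]

lemma Good.τsc (G : Good φ τ α s ℓ p) {w : Fin N} (h : s w = -1) : (φ * α).SameCycle (τ w) w := by
  obtain ⟨k, hk⟩ := G.next w h
  exact (sc_step (φ * α) (τ w)).trans hk.sc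

lemma exists_bound {N : ℕ} (ℓ : Fin N → ℤ) : ∃ M, ∀ x, ℓ x ≤ M := by
  obtain ⟨M, hM⟩ := (Set.finite_range ℓ).bddAbove
  exact ⟨M, fun x => hM ⟨x, rfl⟩⟩

lemma Good.first (G : Good φ τ α s ℓ p) (x : Fin N) (hx : s x ≠ -1) :
    ∃ k, First (φ * τ) (fun y => ℓ y ≤ ℓ x) k ((φ * τ) x) ((φ * α) x) := by
  obtain ⟨M, hM⟩ := exists_bound ℓ
  have main : ∀ t : ℕ, ∀ x, s x ≠ -1 → M - ℓ x ≤ t →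
      ∃ k, First (φ * τ) (fun y => ℓ y ≤ ℓ x) k ((φ * τ) x) ((φ * α) x) := by
    intro t
    induction t with
    | zero =>
      intro x hx ht
      rcases G.s3 x with h | h | h
      · exact absurd h hx
      · refine ⟨0, ?_⟩
        have : (φ * τ) x = (φ * α) x := by simp [Perm.mul_apply, G.τB x h]
        rw [this]
        exact First.here _ (G.hσ x).le
      · have h1 := hM (α x)
        rw [G.lα, h] at h1
        push_cast at ht
        omega
    | succ t ih =>
      intro x hx ht
      rcases G.s3 x with h | h | h
      · exact absurd h hx
      · refine ⟨0, ?_⟩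
        have : (φ * τ) x = (φ * α) x := by simp [Perm.mul_apply, G.τB x h]
        rw [this]
        exact First.here _ (G.hσ x).le
      · have hαx : s (α x) = -1 := by rw [G.sα, h]
        obtain ⟨w, hw⟩ : ∃ w, τ w = α x := ⟨τ⁻¹ (α x), app_inv _ _⟩
        have hsw : s w = -1 := by rw [← G.sτ, hw, hαx]
        have hζw : (φ * τ) w = (φ * α) x := by simp [Perm.mul_apply, hw]
        obtain ⟨k, hk⟩ := G.next w hsw
        rw [hw, G.hα] at hk
        have hζx : (φ * τ) x = φ x := by simp [Perm.mul_apply, G.τL x h]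
        rw [hζx, ← hζw]
        have hlw : ℓ w = ℓ x + 1 := by rw [← G.lτ, hw, G.lα, h]
        have claim : ∀ k y, First (φ * α) (fun x => s x = -1) k y w → ℓ y = ℓ x + 1 →
            ∃ j, First (φ * τ) (fun y => ℓ y ≤ ℓ x) j y ((φ * τ) w) := by
          intro k y hy
          generalize hw' : w = w' at hy ⊢
          induction hy with
          | here d hd =>
            intro hl
            subst hw'
            refine ⟨_, First.step _ _ _ (by omega) (First.here _ ?_)⟩
            rw [hζw]
            exact (G.hσ x).le
          | step k d w' hd _ ih2 =>
            intro hl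
            obtain ⟨j, hj⟩ := ih2 hw' (by rw [Perm.mul_apply, G.hσ, hl])
            obtain ⟨i, hi⟩ := ih d hd (by push_cast at ht; omega)
            obtain ⟨r, hr⟩ := First.cat (P := fun y => ℓ y ≤ ℓ x) (fun y hy => by
              show ℓ y ≤ ℓ d
              have : ℓ y ≤ ℓ x := hy
              omega) hi hj
            exact ⟨_, First.step _ _ _ (by omega) hr⟩
        exact claim k _ hk (by rw [G.stepφ, h])
  exact main (M - ℓ x).toNat x hx (by omega)

lemma First.mulclosed {R : Fin N → Prop} {P : Fin N → Prop} {k : ℕ} {a b : Fin N}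
    (h : First (φ * τ) P k a b) (h1 : ∀ x, R x → R (φ x)) (h2 : ∀ x, R x → R (τ x)) (ha : R a) :
    R b :=
  h.closed (fun x _ hx => h1 _ (h2 _ hx)) ha

lemma Good.reach {R : Fin N → Prop} (G : Good φ τ α s ℓ p)
    (h1 : ∀ x, R x → R ((φ * α) x))
    (h2 : ∀ x, s x = -1 → R x → ∃ y, R y ∧ ℓ y = ℓ x - 1) (h : ∃ x, R x) : R p := by
  obtain ⟨x, hx⟩ := h
  have main : ∀ t : ℕ, ∀ x, R x → ℓ x = t → R p := by
    intro t
    induction t with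
    | zero =>
      intro x hx hl
      exact sc_closed h1 ((G.zero x).1 (by simpa using hl)).symm hx
    | succ t ih =>
      intro x hx hl
      obtain ⟨w, hw, hsw⟩ := G.desc x (by rw [hl]; positivity)
      obtain ⟨y, hy, hly⟩ := h2 w hsw (sc_closed h1 hw hx)
      refine ih y hy ?_
      rw [hly, G.lsc hw, hl]
      push_cast
      ring
  exact main (ℓ x).toNat x hx (by have := G.nonneg x; omega)

lemma Good.trs_map (G : Good φ τ α s ℓ p) : Trs (φ * α) α :=
  trs_of p fun R hR h1 h2 => G.reach h1 (fun x hs hx => ⟨α x, h2 _ hx, by rw [G.lα, hs]; ring⟩) hR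

lemma Good.trs_mob (G : Good φ τ α s ℓ p) : Trs φ τ := by
  refine trs_of p fun R hR h1 h2 => ?_
  have hnW : ∀ x, s x ≠ -1 → R x → R ((φ * α) x) := by
    intro x hs hx
    obtain ⟨k, hk⟩ := G.first x hs
    exact hk.mulclosed h1 h2 (h1 _ (h2 _ hx))
  obtain ⟨x, hx⟩ := hR
  have main : ∀ t : ℕ, ∀ x, R x → ℓ x = t → R p := by
    intro t
    induction t with
    | zero =>
      intro x hx hl
      have := (G.zero x).1 (by simpa using hl)
      refine (sc_closed (P := fun y => R y ∧ ℓ y = 0) ?_ this.symm ⟨hx, by simpa using hl⟩).1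
      rintro y ⟨hy, hly⟩
      refine ⟨hnW y (fun hs => ?_) hy, (G.hσ y).trans hly⟩
      have h3 := G.stepφ y
      have h4 := G.nonneg (φ y)
      omega
    | succ t ih =>
      intro x hx hl
      obtain ⟨w, hw, hsw⟩ := G.desc x (by rw [hl]; positivity)
      obtain ⟨k, w', hk⟩ := First.of_sc (P := fun x => s x = -1) hw hsw
      have hw' : R w' := hk.closed (fun y hy => hnW y hy) hx
      refine ih (φ w') (h1 _ hw') ?_
      have hs' : s w' = -1 := hk.prop
      rw [G.stepφ, G.lsc hk.sc, hl, hs']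
      push_cast
      ring
  exact main (ℓ x).toNat x hx (by have := G.nonneg x; omega)

lemma Good.wsc (G : Good φ τ α s ℓ p) {w w' : Fin N} (hw : s w = -1) (hw' : s w' = -1) :
    τ.SameCycle w w' ↔ (φ * α).SameCycle w w' := by
  constructor
  · intro h
    refine (sc_closed (P := fun y => s y = -1 ∧ (φ * α).SameCycle w y) ?_ h
      ⟨hw, SameCycle.refl _ _⟩).2
    rintro y ⟨hy, h1⟩
    exact ⟨by rw [G.sτ, hy], h1.trans (G.τsc hy).symm⟩
  · intro h
    obtain ⟨k, c, hk⟩ := First.of_sc (P := fun y => y = w') h rfl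
    have main : ∀ t : ℕ, ∀ k ≤ t, ∀ w c, s w = -1 → First (φ * α) (fun y => y = w') k w c →
        τ.SameCycle w w' := by
      intro t
      induction t with
      | zero =>
        intro k hk w c hs hF
        obtain rfl : k = 0 := by omega
        cases hF with
        | here _ h => rw [h]
      | succ t ih =>
        intro k hk w c hs hF
        cases hF with
        | here _ h => rw [h]
        | step k _ _ h1 h2 =>
          obtain ⟨v, rfl⟩ : ∃ v, τ v = w := ⟨τ⁻¹ w, app_inv _ _⟩
          rw [G.sτ] at hs
          obtain ⟨j, hj⟩ := G.next v hs
          obtain ⟨i, hi, hF⟩ := First.split (P := fun y => y = w') (fun y hy => by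
            show s y = -1
            rw [show y = w' from hy, hw']) hj h2
          exact (sc_step τ v).symm.trans (ih i (by omega) v c hs hF)
    exact main k k le_rfl w c hw hk

lemma Good.count (G : Good φ τ α s ℓ p) : cycleCountOn τ (fun x => s x = -1) =
    cycleCountOn (φ * α) (fun x => ¬ (φ * α).SameCycle p x) := by
  refine cc_congr (fun x _ => x) ?_ (fun x hx y hy => G.wsc hx hy) ?_
  · intro x hx h
    rw [← G.zero] at h
    have h3 := G.stepφ x
    have h4 := G.nonneg (φ x)
    omega
  · intro y hy
    rw [← G.zero] at hy
    obtain ⟨w, h1, h2⟩ := G.desc y (lt_of_le_of_ne (G.nonneg y) (Ne.symm hy))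
    exact ⟨w, h2, h1.symm⟩

lemma Good.countσ (G : Good φ τ α s ℓ p) : cycleCount (φ * α) =
    cycleCountOn τ (fun x => s x = -1) + 1 := by
  rw [G.count, ← cc_split (σ := φ * α) (P := fun x => (φ * α).SameCycle p x)
    (fun x hx => hx.trans (sc_step _ x)), cc_one]
  ring

lemma Good.rm (G : Good φ τ α s ℓ p) (hc : 2 * (cycleCount (φ * α) + cycleCount φ) = N + 4) :
    RM φ τ s where
  s3 := G.s3
  τL := G.τL
  τB := fun x hx => by
    rw [G.τB x hx]
    refine ⟨G.ne x, ?_⟩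
    rw [G.τB _ (by rw [G.sα, hx, neg_zero]), G.hα]
  sτ := G.sτ
  trs := G.trs_mob
  tree := by have := G.countσ; omega
  bal := balanced_of_potential G.s3 G.stepφ

/-- the map determines the mobile -/
lemma Good.unique_mob {τ' : Perm (Fin N)} {s' ℓ' : Fin N → ℤ} {p' : Fin N}
    (G : Good φ τ α s ℓ p) (G' : Good φ τ' α s' ℓ' p') (hp : (φ * α).SameCycle p p') :
    s' = s ∧ τ' = τ := by
  have hle : ∀ {τ τ' : Perm (Fin N)} {s ℓ s' ℓ' : Fin N → ℤ} {p p' : Fin N},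
      Good φ τ α s ℓ p → Good φ τ' α s' ℓ' p' → (φ * α).SameCycle p p' → ∀ x, ℓ' x ≤ ℓ x := by
    intro τ τ' s ℓ s' ℓ' p p' G G' hp
    have main : ∀ t : ℕ, ∀ x, ℓ x = t → ℓ' x ≤ t := by
      intro t
      induction t with
      | zero =>
        intro x hl
        have h1 := (G.zero x).1 (by simpa using hl)
        have h2 := (G'.zero x).2 (hp.symm.trans h1)
        simp [h2]
      | succ t ih =>
        intro x hl
        obtain ⟨w, h1, h2⟩ := G.desc x (by rw [hl]; positivity)
        have h3 := ih (α w) (by rw [G.lα, G.lsc h1, hl, h2]; push_cast; ring)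
        have h4 := G'.lsc h1
        have h5 := G'.lα w
        have h6 := G'.s3 w
        push_cast
        omega
    intro x
    have := main (ℓ x).toNat x (by have := G.nonneg x; omega)
    have := G.nonneg x
    omega
  have hl : ℓ' = ℓ := funext fun x => le_antisymm (hle G G' hp x) (hle G' G hp.symm x)
  subst hl
  have hs : s' = s := funext fun x => by
    have h1 := G.stepφ x
    have h2 := G'.stepφ x
    linarith
  subst hs
  refine ⟨rfl, ?_⟩
  ext1 x
  rcases G.s3 x with h | h | h
  · obtain ⟨v, hv⟩ : ∃ v, τ v = τ' x := ⟨τ⁻¹ (τ' x), app_inv _ _⟩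
    have hsv : s' v = -1 := by rw [← G.sτ, hv, G'.sτ, h]
    obtain ⟨k, hk⟩ := G.next v hsv
    obtain ⟨j, hj⟩ := G'.next x h
    rw [hv] at hk
    have := hk.eq hj
    rw [← hv, this]
  · rw [G.τB x h, G'.τB x h]
  · rw [G.τL x h, G'.τL x h]

/-- the mobile determines the map -/
lemma Good.unique_map {α' : Perm (Fin N)} {ℓ' : Fin N → ℤ} {p' : Fin N}
    (G : Good φ τ α s ℓ p) (G' : Good φ τ α' s ℓ' p') : α' = α ∧ (φ * α).SameCycle p p' := by
  have hconst := G.trs_mob.const (f := fun x => ℓ' x - ℓ x)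
    (fun x => by rw [G.stepφ, G'.stepφ]; ring) (fun x => by rw [G.lτ, G'.lτ])
  have hl : ℓ' = ℓ := by
    have hp := (G.zero p).2 (SameCycle.refl _ _)
    have hp' := (G'.zero p').2 (SameCycle.refl _ _)
    have h1 := hconst p p'
    have h2 := G.nonneg p'
    have h3 := G'.nonneg p
    funext x
    have h4 := hconst p x
    omega
  subst hl
  have h1 : ∀ x, s x ≠ -1 → α' x = α x := by
    intro x hx
    obtain ⟨k, hk⟩ := G.first x hx
    obtain ⟨j, hj⟩ := G'.first x hx
    have := hk.eq hj
    exact (φ.injective this).symm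
  have h2 : α' = α := by
    ext1 x
    by_cases hx : s x = -1
    · have h3 := h1 (α x) (by rw [G.sα, hx]; norm_num)
      rw [G.hα] at h3
      have := congrArg α' h3
      rw [G'.hα] at this
      exact this.symm
    · exact h1 x hx
  refine ⟨h2, ?_⟩
  rw [← G.zero]
  exact (G'.zero p').2 (SameCycle.refl _ _)

/-- transport -/
lemma Good.conj (G : Good φ τ α s ℓ p) (π : Perm (Fin N)) :
    Good (π * φ * π⁻¹) (π * τ * π⁻¹) (π * α * π⁻¹) (fun x => s (π⁻¹ x)) (fun x => ℓ (π⁻¹ x))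
      (π p) := by
  have hσ : π * φ * π⁻¹ * (π * α * π⁻¹) = π * (φ * α) * π⁻¹ := by group
  have hF : ∀ {P : Fin N → Prop} {k a b}, First (φ * α) P k a b →
      First (π * (φ * α) * π⁻¹) (fun x => P (π⁻¹ x)) k (π a) (π b) := by
    intro P k a b h
    induction h with
    | here d h => exact First.here _ (by rwa [inv_app])
    | step k d w h _ ih =>
      refine First.step _ _ _ (by rwa [inv_app]) ?_
      have : (π * (φ * α) * π⁻¹) (π d) = π ((φ * α) d) := by simp [Perm.mul_apply]
      rw [this]
      exact ih
  constructor
  · intro x; simp [Perm.mul_apply, G.hα]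
  · intro x h
    simp only [Perm.mul_apply] at h
    have := congrArg (fun y => π⁻¹ y) h
    simp only [inv_app] at this
    exact G.ne _ this
  · intro x; exact G.nonneg _
  · intro x; simp only [Perm.mul_apply, inv_app]; exact G.stepφ _
  · intro x; simp only [Perm.mul_apply, inv_app]; exact G.hσ _
  · intro x; exact G.s3 _
  · intro x; rw [hσ, sameCycle_conj, inv_app]; exact G.zero _
  · intro x hx
    obtain ⟨w, h1, h2⟩ := G.desc _ hx
    refine ⟨π w, ?_, by rw [inv_app, h2]⟩
    rw [hσ, sameCycle_conj, inv_app]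
    exact h1
  · intro x hx; simp only [Perm.mul_apply]; rw [G.τL _ hx, app_inv]
  · intro x hx; simp only [Perm.mul_apply]; rw [G.τB _ hx]
  · intro x; simp only [Perm.mul_apply, inv_app]; exact G.sτ _
  · intro w hw
    obtain ⟨k, hk⟩ := G.next _ hw
    refine ⟨k, ?_⟩
    have h1 := hF hk
    rw [app_inv] at h1
    rw [hσ]
    simpa only [Perm.mul_apply, inv_app] using h1

end
end BDG
set_option linter.all false
namespace BDG
open Equiv Equiv.Perm

def Reach {N : ℕ} (σ α : Perm (Fin N)) (p : Fin N) : ℕ → Fin N → Prop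
  | 0, d => σ.SameCycle p d
  | (k+1), d => Reach σ α p k d ∨ ∃ x, Reach σ α p k x ∧ σ.SameCycle (α x) d

lemma exists_dist {N : ℕ} {σ α : Perm (Fin N)} (p : Fin N) (hα : ∀ x, α (α x) = x)
    (ht : Trs σ α) : ∃ ℓ : Fin N → ℤ, (∀ x, 0 ≤ ℓ x) ∧ (∀ x, ℓ (σ x) = ℓ x) ∧
      (∀ x, ℓ (α x) ≤ ℓ x + 1) ∧ (∀ x, ℓ x = 0 ↔ σ.SameCycle p x) ∧
      ∀ x, 0 < ℓ x → ∃ w, σ.SameCycle x w ∧ ℓ (α w) = ℓ w - 1 := by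
  classical
  have hex : ∀ x, ∃ k, Reach σ α p k x := by
    refine ht _ ⟨p, 0, SameCycle.refl _ _⟩ ?_ ?_
    · rintro x ⟨k, hk⟩
      cases k with
      | zero => exact ⟨0, SameCycle.trans hk (sc_step σ x)⟩
      | succ k =>
        rcases hk with hk | ⟨y, h1, h2⟩
        · exact ⟨k + 2, Or.inr ⟨α x, Or.inr ⟨x, hk, SameCycle.refl _ _⟩, by
            rw [hα]; exact sc_step σ x⟩⟩
        · exact ⟨k+1, Or.inr ⟨y, h1, h2.trans (sc_step σ x)⟩⟩
    · rintro x ⟨k, hk⟩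
      exact ⟨k+1, Or.inr ⟨x, hk, SameCycle.refl _ _⟩⟩
  have hσ : ∀ k x, Reach σ α p k x → Reach σ α p k (σ x) := by
    intro k
    induction k with
    | zero => intro x hx; exact SameCycle.trans hx (sc_step σ x)
    | succ k ih =>
      rintro x (hx | ⟨y, h1, h2⟩)
      · exact Or.inl (ih x hx)
      · exact Or.inr ⟨y, h1, h2.trans (sc_step σ x)⟩
  let L : Fin N → ℕ := fun x => Nat.find (hex x)
  have hL : ∀ x, Reach σ α p (L x) x := fun x => Nat.find_spec (hex x)
  have hmin : ∀ x k, Reach σ α p k x → L x ≤ k := fun x k h => Nat.find_min' (hex x) h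
  have hLσ : ∀ x, L (σ x) = L x := fun x => le_antisymm (hmin _ _ (hσ _ _ (hL x)))
    (hmin _ _ ((closed_iff (hσ _) x).1 (hL (σ x))))
  have hLα : ∀ x, L (α x) ≤ L x + 1 := fun x => hmin _ _ (Or.inr ⟨x, hL x, SameCycle.refl _ _⟩)
  refine ⟨fun x => L x, fun x => by positivity, fun x => by simp only [hLσ], fun x => by
    have := hLα x
    show (L (α x) : ℤ) ≤ (L x : ℤ) + 1
    omega, fun x => ?_, fun x hx => ?_⟩
  · constructor
    · intro h
      have h' : (L x : ℤ) = 0 := h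
      have h0 : L x = 0 := by omega
      have := hL x
      rw [h0] at this
      exact this
    · intro h
      have : L x ≤ 0 := hmin x 0 h
      simp only; omega
  · have hx'' : (0 : ℤ) < (L x : ℤ) := hx
    have hx' : 0 < L x := by omega
    obtain ⟨k, hk⟩ : ∃ k, L x = k + 1 := ⟨L x - 1, by omega⟩
    have h1 := hL x
    rw [hk] at h1
    rcases h1 with h1 | ⟨y, h1, h2⟩
    · have := hmin _ _ h1; omega
    · refine ⟨α y, h2.symm, ?_⟩
      have h3 := hmin _ _ h1
      have h4 : L x = L (α y) := inv_of_step hLσ h2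
      have h5 := hLα y
      simp only [hα]
      omega

lemma exists_good_of_map {N : ℕ} {σ α : Perm (Fin N)} (p : Fin N) (hα : ∀ x, α (α x) = x)
    (hne : ∀ x, α x ≠ x) (ht : Trs σ α) : ∃ τ s ℓ, Good (σ * α) τ α s ℓ p := by
  classical
  obtain ⟨ℓ, h0, hσ, hstep, hzero, hdesc⟩ := exists_dist p hα ht
  have hσα : σ * α * α = σ := by ext1 x; simp [Perm.mul_apply, hα]
  let s : Fin N → ℤ := fun x => ℓ (α x) - ℓ x
  have hs : ∀ x, s x = ℓ (α x) - ℓ x := fun x => rfl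
  have hsα : ∀ x, s (α x) = - s x := fun x => by rw [hs, hs, hα]; ring
  have s3 : ∀ x, s x = -1 ∨ s x = 0 ∨ s x = 1 := by
    intro x
    have h1 := hstep x
    have h2 := hstep (α x)
    rw [hα] at h2
    have := hs x
    omega
  have hnext : ∀ w : {x // s x = -1}, ∃ c k, First σ (fun x => s x = -1) k (σ w.1) c := by
    intro w
    obtain ⟨k, c, h⟩ := First.of_sc (P := fun x => s x = -1) (sc_step σ w.1).symm w.2
    exact ⟨c, k, h⟩
  choose nx hnx using hnext
  let nW : {x // s x = -1} → {x // s x = -1} := fun w => ⟨nx w, (hnx w).choose_spec.prop⟩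
  have hinj : Function.Injective nW := by
    intro a b hab
    have h1 : nx a = nx b := congrArg Subtype.val hab
    obtain ⟨k, hk⟩ := hnx a
    obtain ⟨j, hj⟩ := hnx b
    rw [← h1] at hj
    exact Subtype.ext (First.inj σ.injective (P := fun x => s x = -1) a.2 b.2 hk hj)
  let eW : {x // s x = -1} ≃ {x // s x = -1} :=
    Equiv.ofBijective nW (Finite.injective_iff_bijective.1 hinj)
  let t : Fin N → Fin N := fun x =>
    if h : s x = -1 then (eW.symm ⟨x, h⟩).1 else if s x = 0 then α x else x
  have tW : ∀ x (h : s x = -1), t x = (eW.symm ⟨x, h⟩).1 := fun x h => by simp [t, h]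
  have tB : ∀ x, s x = 0 → t x = α x := fun x h => by simp [t, h]
  have tL : ∀ x, s x = 1 → t x = x := fun x h => by simp [t, h]
  have st : ∀ x, s (t x) = s x := by
    intro x
    rcases s3 x with h | h | h
    · rw [tW x h, h]; exact (eW.symm ⟨x, h⟩).2
    · rw [tB x h, hsα, h, neg_zero]
    · rw [tL x h]
  have tinj : Function.Injective t := by
    intro x y hxy
    have h1 : s x = s y := by rw [← st x, ← st y, hxy]
    rcases s3 y with h | h | h
    · rw [tW x (h1.trans h), tW y h] at hxy
      have := eW.symm.injective (Subtype.ext hxy)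
      exact congrArg Subtype.val this
    · rw [tB x (h1.trans h), tB y h] at hxy
      exact α.injective hxy
    · rwa [tL x (h1.trans h), tL y h] at hxy
  let τ : Perm (Fin N) := Equiv.ofBijective t (Finite.injective_iff_bijective.1 tinj)
  have hτ : ∀ x, τ x = t x := fun x => rfl
  refine ⟨τ, s, ℓ, ?_⟩
  constructor
  · exact hα
  · exact hne
  · exact h0
  · intro x; rw [Perm.mul_apply, hσ, hs]; ring
  · intro x; rw [Perm.mul_apply, hσ, hα]
  · exact s3
  · rw [hσα]; exact hzero
  · rw [hσα]
    intro x hx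
    obtain ⟨w, h1, h2⟩ := hdesc x hx
    exact ⟨w, h1, by rw [hs, h2]; ring⟩
  · intro x hx; rw [hτ, tL x hx]
  · intro x hx; rw [hτ, tB x hx]
  · exact st
  · intro w hw
    rw [hσα, Perm.mul_apply, hα, hτ, tW w hw]
    obtain ⟨k, hk⟩ := hnx (eW.symm ⟨w, hw⟩)
    have : nx (eW.symm ⟨w, hw⟩) = w :=
      congrArg Subtype.val (eW.apply_symm_apply ⟨w, hw⟩)
    rw [this] at hk
    exact ⟨k, hk⟩

lemma First.pred {D : Type*} {f : D → D} {P : D → Prop} {k : ℕ} {a c : D} (h : First f P k a c)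
    (ha : ¬ P a) : ∃ b, ¬ P b ∧ f b = c := by
  induction h with
  | here d h => exact absurd h ha
  | step k d w h1 h2 ih =>
    by_cases hd : P (f d)
    · refine ⟨d, h1, ?_⟩
      cases h2 with
      | here _ _ => rfl
      | step _ _ _ h3 _ => exact absurd hd h3
    · exact ih hd

lemma RM.enough {N : ℕ} {φ τ : Perm (Fin N)} {s : Fin N → ℤ} (R : RM φ τ s) :
    N + 1 ≤ cycleCount φ + cycleCount τ := by
  classical
  obtain ⟨g, hg⟩ := exists_potential R.s3 R.bal
  have hLW := card_of_potential R.s3 hg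
  have h1 := cc_split (σ := τ) (P := fun x => s x = -1) (fun x hx => by rw [R.sτ, hx])
  have h2 := cc_invol (τ := τ) (P := fun x => ¬ s x = -1) (by
    intro x hx
    rcases R.s3 x with h | h | h
    · exact absurd h hx
    · exact (R.τB x h).2
    · rw [R.τL x h, R.τL x h])
  have h3 : Nat.card {x // ¬ s x = -1 ∧ τ x = x} = Nat.card {x // s x = 1} := by
    refine Nat.card_congr (Equiv.subtypeEquivRight fun x => ?_)
    rcases R.s3 x with h | h | h
    · simp [h]
    · simp [h, (R.τB x h).1]
    · simp [h, R.τL x h]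
  have h4 : Nat.card {x // s x = -1} + Nat.card {x // ¬ s x = -1} = N := by
    rw [← Nat.card_sum, Nat.card_congr (Equiv.sumCompl (fun x => s x = -1)), Nat.card_fin]
  have := R.tree
  omega

lemma RM.labels {N : ℕ} {φ τ : Perm (Fin N)} {s : Fin N → ℤ} (R : RM φ τ s) :
    ∃ (ℓ : Fin N → ℤ) (p : Fin N), (∀ x, 0 ≤ ℓ x) ∧ ℓ p = 0 ∧ (∀ x, ℓ (φ x) = ℓ x + s x) ∧
      ∀ x, ℓ (τ x) = ℓ x := by
  obtain ⟨g, hg⟩ := exists_potential R.s3 R.bal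
  obtain ⟨a, b, ha, hb, hab⟩ := tree_decomp R.trs R.enough g
  have hne : Nonempty (Fin N) := by
    by_contra hc
    rw [not_nonempty_iff] at hc
    have h1 : cycleCount φ = 0 := by
      unfold cycleCount cycleCountOn
      rw [Nat.card_eq_zero]; left
      exact ⟨fun q => by obtain ⟨x, rfl⟩ := Quot.exists_rep q; exact hc.elim x.1⟩
    have h2 : cycleCountOn τ (fun x => s x = -1) = 0 := by
      unfold cycleCountOn
      rw [Nat.card_eq_zero]; left
      exact ⟨fun q => by obtain ⟨x, rfl⟩ := Quot.exists_rep q; exact hc.elim x.1⟩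
    have := R.tree
    omega
  have hbφ : ∀ x, b (φ x) = b x + s x := by
    intro x
    have h1 := hab x
    have h2 := hab (φ x)
    rw [ha, hg] at h2
    linarith
  obtain ⟨p, hp⟩ := Finite.exists_min b
  have hint : ∀ x, ∃ k : ℤ, b x - b p = k := by
    refine R.trs _ ⟨p, 0, by simp⟩ ?_ ?_
    · rintro x ⟨k, hk⟩
      exact ⟨k + s x, by rw [hbφ]; push_cast; linarith⟩
    · rintro x ⟨k, hk⟩
      exact ⟨k, by rw [hb, hk]⟩
  choose ℓ hℓ using hint
  refine ⟨ℓ, p, fun x => ?_, ?_, fun x => ?_, fun x => ?_⟩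
  · have : (0:ℚ) ≤ ℓ x := by rw [← hℓ]; linarith [hp x]
    exact_mod_cast this
  · have : (ℓ p : ℚ) = 0 := by rw [← hℓ]; ring
    exact_mod_cast this
  · have : (ℓ (φ x) : ℚ) = ℓ x + s x := by rw [← hℓ, ← hℓ, hbφ]; ring
    exact_mod_cast this
  · have : (ℓ (τ x) : ℚ) = ℓ x := by rw [← hℓ, ← hℓ, hb]
    exact_mod_cast this

lemma exists_good_of_rm {N : ℕ} {φ τ : Perm (Fin N)} {s : Fin N → ℤ} (R : RM φ τ s) :
    ∃ α ℓ p, Good φ τ α s ℓ p := by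
  classical
  obtain ⟨ℓ, p, h0, hp, hφ, hτ⟩ := R.labels
  have hone := tree_onecycle R.trs R.enough
  have hcard : Nat.card {x // s x = 1} = Nat.card {x // s x = -1} := by
    obtain ⟨g, hg⟩ := exists_potential R.s3 R.bal
    exact card_of_potential R.s3 hg
  have hζ : ∀ x, ℓ ((φ * τ) x) = ℓ x + s x := fun x => by
    rw [Perm.mul_apply, hφ, hτ, R.sτ]
  have hz : ∀ x : {x // s x = 1}, ∃ y : {y // s y = -1}, ℓ y.1 = ℓ x.1 + 1 ∧
      ∃ k, First (φ * τ) (fun z => ℓ z ≤ ℓ x.1) k ((φ * τ) x.1) (φ y.1) := by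
    rintro ⟨x, hx⟩
    obtain ⟨k, c, hk⟩ := First.of_sc (P := fun z => ℓ z ≤ ℓ x) (hone ((φ * τ) x) x) le_rfl
    have hc : ℓ x ≤ ℓ c := hk.closed (R := fun z => ℓ x ≤ ℓ z) (by
      intro y hy _
      have h1 := hζ y
      have h2 := R.s3 y
      have hy' : ¬ ℓ y ≤ ℓ x := hy
      show ℓ x ≤ ℓ ((φ * τ) y)
      omega) (by rw [hζ, hx]; omega)
    have hc' : ℓ c ≤ ℓ x := hk.prop
    obtain ⟨w, hw, hwc⟩ := hk.pred (by rw [hζ, hx]; omega)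
    have hw' : ¬ ℓ w ≤ ℓ x := hw
    have h1 := hζ w
    rw [hwc] at h1
    have h2 := R.s3 w
    refine ⟨⟨τ w, by rw [R.sτ]; omega⟩, by show ℓ (τ w) = ℓ x + 1; rw [hτ]; omega, k, ?_⟩
    rw [← Perm.mul_apply, hwc]
    exact hk
  choose u hu1 hu2 using hz
  have uinj : Function.Injective u := by
    intro x y hxy
    obtain ⟨k, hk⟩ := hu2 x
    obtain ⟨j, hj⟩ := hu2 y
    have hl : ℓ x.1 = ℓ y.1 := by
      have h1 := hu1 x
      have h2 := hu1 y
      rw [hxy] at h1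
      omega
    rw [← hxy, ← hl] at hj
    exact Subtype.ext (First.inj (φ * τ).injective (P := fun z => ℓ z ≤ ℓ x.1) (le_refl (ℓ x.1))
      hl.ge hk hj)
  let e : {x // s x = 1} ≃ {y // s y = -1} := Equiv.ofBijective u
    ((Nat.bijective_iff_injective_and_card u).2 ⟨uinj, hcard⟩)
  let A : Fin N → Fin N := fun x =>
    if h : s x = 1 then (e ⟨x, h⟩).1 else if h : s x = -1 then (e.symm ⟨x, h⟩).1 else τ x
  have AL : ∀ x (h : s x = 1), A x = (e ⟨x, h⟩).1 := fun x h => by simp [A, h]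
  have AW : ∀ x (h : s x = -1), A x = (e.symm ⟨x, h⟩).1 := fun x h => by simp [A, h]
  have AB : ∀ x (h : s x = 0), A x = τ x := fun x h => by simp [A, h]
  have sA : ∀ x, s (A x) = - s x := by
    intro x
    rcases R.s3 x with h | h | h
    · rw [AW x h, h, (e.symm ⟨x, h⟩).2]; norm_num
    · rw [AB x h, R.sτ, h, neg_zero]
    · rw [AL x h, h, (e ⟨x, h⟩).2]
  have hA : Function.Involutive A := by
    intro x
    rcases R.s3 x with h | h | h
    · have h1 : s (A x) = 1 := by rw [sA, h]; norm_num
      rw [AL _ h1]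
      have : (⟨A x, h1⟩ : {x // s x = 1}) = e.symm ⟨x, h⟩ := Subtype.ext (AW x h)
      rw [this, e.apply_symm_apply]
    · rw [AB x h, AB _ (by rw [R.sτ, h]), (R.τB x h).2]
    · have h1 : s (A x) = -1 := by rw [sA, h]
      rw [AW _ h1]
      have : (⟨A x, h1⟩ : {x // s x = -1}) = e ⟨x, h⟩ := Subtype.ext (AL x h)
      rw [this, e.symm_apply_apply]
  let α : Perm (Fin N) := hA.toPerm A
  have hα : ∀ x, α x = A x := fun x => rfl
  have lL : ∀ x, s x = 1 → ℓ (α x) = ℓ x + 1 := fun x h => by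
    rw [hα, AL x h]; exact hu1 ⟨x, h⟩
  have lα : ∀ x, ℓ (α x) = ℓ x + s x := by
    intro x
    rcases R.s3 x with h | h | h
    · have h1 := lL (α x) (by rw [hα, sA, h]; norm_num)
      rw [hα (α x), hα x, hA x] at h1
      rw [hα x, h]; omega
    · rw [hα, AB x h, hτ, h, add_zero]
    · rw [lL x h, h]
  have hσ : ∀ x, ℓ (φ (α x)) = ℓ x := fun x => by rw [hφ, lα, hα, sA]; ring
  have hfirst : ∀ x, s x ≠ -1 →
      ∃ k, First (φ * τ) (fun y => ℓ y ≤ ℓ x) k ((φ * τ) x) ((φ * α) x) := by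
    intro x hx
    rcases R.s3 x with h | h | h
    · exact absurd h hx
    · refine ⟨0, ?_⟩
      have : (φ * τ) x = (φ * α) x := by rw [Perm.mul_apply, Perm.mul_apply, hα, AB x h]
      rw [this]
      exact First.here _ (hσ x).le
    · rw [Perm.mul_apply φ α, hα, AL x h]
      exact hu2 ⟨x, h⟩
  have claim1 : ∀ t : ℕ, ∀ k ≤ t, ∀ x z i, First (φ * τ) (fun y => ℓ y ≤ i) k x z → ℓ x = i + 1 →
      ∃ w, s w = -1 ∧ z = (φ * τ) w ∧ ∃ j, First (φ * α) (fun x => s x = -1) j x w := by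
    intro t
    induction t with
    | zero =>
      intro k hk x z i hF hl
      obtain rfl : k = 0 := by omega
      cases hF with
      | here _ h => omega
    | succ t ih =>
      intro k hk x z i hF hl
      cases hF with
      | here _ h => omega
      | step k _ _ h1 h2 =>
        by_cases hx : s x = -1
        · refine ⟨x, hx, ?_, 0, First.here _ hx⟩
          have h3 : ℓ ((φ * τ) x) ≤ i := by rw [hζ, hx]; omega
          exact h2.eq (First.here _ h3)
        · obtain ⟨j, hj⟩ := hfirst x hx
          obtain ⟨r, hr, hF⟩ := First.split (P := fun y => ℓ y ≤ i) (fun y hy => by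
            have : ℓ y ≤ i := hy
            show ℓ y ≤ ℓ x
            omega) hj h2
          obtain ⟨w, hw1, hw2, q, hq⟩ := ih r (by omega) _ z i hF (by rw [Perm.mul_apply, hσ, hl])
          exact ⟨w, hw1, hw2, _, First.step _ _ _ hx hq⟩
  have claim2 : ∀ t : ℕ, ∀ k ≤ t, ∀ x y z, First (φ * τ) (fun z => z = y) k x z → ℓ x = 0 → ℓ y = 0 →
      (φ * α).SameCycle x y := by
    intro t
    induction t with
    | zero =>
      intro k hk x y z hF hx hy
      obtain rfl : k = 0 := by omega
      cases hF with
      | here _ h => rw [h]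
    | succ t ih =>
      intro k hk x y z hF hx hy
      cases hF with
      | here _ h => rw [h]
      | step k _ _ h1 h2 =>
        have hsx : s x ≠ -1 := by
          intro hs
          have h3 := hφ x
          have h4 := h0 (φ x)
          omega
        obtain ⟨j, hj⟩ := hfirst x hsx
        obtain ⟨r, hr, hF⟩ := First.split (P := fun z => z = y) (fun z hz => by
            show ℓ z ≤ ℓ x
            rw [show z = y from hz]; omega) hj h2
        exact (sc_step _ x).trans (ih r (by omega) _ y z hF (by rw [Perm.mul_apply, hσ, hx]) hy)
  refine ⟨α, ℓ, p, ?_⟩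
  constructor
  · exact hA
  · intro x hx
    rcases R.s3 x with h | h | h
    · have := sA x; rw [← hα, hx] at this; omega
    · rw [hα, AB x h] at hx; exact (R.τB x h).1 hx
    · have := sA x; rw [← hα, hx] at this; omega
  · exact h0
  · exact hφ
  · exact hσ
  · exact R.s3
  · intro x
    constructor
    · intro hx
      obtain ⟨k, c, hk⟩ := First.of_sc (P := fun z => z = x) (hone p x) rfl
      exact claim2 k k le_rfl _ _ _ hk hp hx
    · intro h
      rw [inv_of_step (f := ℓ) (fun z => hσ z) h, hp]
  · intro x hx
    obtain ⟨k, c, hk⟩ := First.of_sc (P := fun z => ℓ z ≤ ℓ x - 1) (hone x p) (by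
      rw [hp]; omega)
    obtain ⟨w, h1, -, j, hj⟩ := claim1 k k le_rfl _ _ _ hk (by ring)
    exact ⟨w, hj.sc, h1⟩
  · exact R.τL
  · intro x hx; rw [hα, AB x hx]
  · exact R.sτ
  · intro w hw
    have hl : s (α (τ w)) = 1 := by rw [hα, sA, R.sτ, hw]; norm_num
    obtain ⟨k, hk⟩ := hfirst (α (τ w)) (by rw [hl]; norm_num)
    have e1 : (φ * α) (α (τ w)) = (φ * τ) w := by
      rw [Perm.mul_apply, Perm.mul_apply, hα, hα, hA]
    have e2 : (φ * τ) (α (τ w)) = φ (α (τ w)) := by rw [Perm.mul_apply, R.τL _ hl]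
    rw [e1] at hk
    obtain ⟨w', h1, h2, j, hj⟩ := claim1 k k le_rfl _ _ _ hk (by rw [hζ, hl])
    have : w = w' := (φ * τ).injective h2
    subst this
    rw [e2] at hj
    exact ⟨j, hj⟩

end BDG
set_option linter.all false
namespace BDG
open Equiv Equiv.Perm

lemma conj_iff {X : Type*} {π σ σ' : Perm X} : π * σ * π⁻¹ = σ' ↔ ∀ x, π (σ x) = σ' (π x) := by
  constructor
  · rintro rfl x
    simp
  · intro h
    ext x
    have := h (π⁻¹ x)
    rw [app_inv] at this
    rw [Perm.mul_apply, Perm.mul_apply, this]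

structure Emb {m N : ℕ} (σm αm : Perm (Fin m)) (col : Fin m → Bool) (e : Fin N → Fin m)
    (φ τ : Perm (Fin N)) (s : Fin N → ℤ) : Prop where
  inj : Function.Injective e
  col_iff : ∀ y, col y = true ↔ ∃ d, e d = y
  σe : ∀ d, σm (e d) = e (φ d)
  invol : ∀ y, αm (αm y) = y
  s3 : ∀ x, s x = -1 ∨ s x = 0 ∨ s x = 1
  eL : ∀ d, s d = 1 → αm (e d) = e d
  eB : ∀ d, s d = 0 → αm (e d) = e (τ d)
  eW : ∀ d, s d = -1 → col (αm (e d)) = false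
  eWσ : ∀ d, s d = -1 → σm (αm (e d)) = αm (e (τ d))
  surjW : ∀ y, col y = false → ∃ d, s d = -1 ∧ αm (e d) = y
  τL : ∀ x, s x = 1 → τ x = x
  τB : ∀ x, s x = 0 → τ x ≠ x ∧ τ (τ x) = x
  sτ : ∀ x, s (τ x) = s x

section
variable {m N : ℕ} {σm αm : Perm (Fin m)} {col : Fin m → Bool} {e : Fin N → Fin m}
    {φ τ : Perm (Fin N)} {s : Fin N → ℤ}

lemma Emb.cole (E : Emb σm αm col e φ τ s) (d : Fin N) : col (e d) = true := (E.col_iff _).2 ⟨d, rfl⟩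

lemma Emb.leg (E : Emb σm αm col e φ τ s) (d : Fin N) : αm (e d) = e d ↔ s d = 1 := by
  constructor
  · intro h
    rcases E.s3 d with h1 | h1 | h1
    · have := E.eW d h1
      rw [h, E.cole] at this
      cases this
    · rw [E.eB d h1] at h
      exact absurd (E.inj h) (E.τB d h1).1
    · exact h1
  · exact E.eL d

lemma Emb.white (E : Emb σm αm col e φ τ s) (d : Fin N) : col (αm (e d)) = false ↔ s d = -1 := by
  constructor
  · intro h
    rcases E.s3 d with h1 | h1 | h1
    · exact h1
    · rw [E.eB d h1, E.cole] at h; cases h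
    · rw [E.eL d h1, E.cole] at h; cases h
  · exact E.eW d

lemma Emb.winj (E : Emb σm αm col e φ τ s) {d d' : Fin N} (h : αm (e d) = αm (e d')) : d = d' :=
  E.inj (αm.injective h)

lemma Emb.colσ (E : Emb σm αm col e φ τ s) (x : Fin m) : col (σm x) = col x := by
  cases h : col x with
  | true =>
    obtain ⟨d, rfl⟩ := (E.col_iff _).1 h
    rw [E.σe, E.cole]
  | false =>
    obtain ⟨d, hd, rfl⟩ := E.surjW _ h
    rw [E.eWσ d hd]
    exact E.eW _ (by rw [E.sτ, hd])

lemma Emb.fixcol (E : Emb σm αm col e φ τ s) (x : Fin m) (h : αm x = x) : col x = true := by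
  by_contra hc
  rw [Bool.not_eq_true] at hc
  obtain ⟨d, hd, rfl⟩ := E.surjW _ hc
  rw [E.invol] at h
  rw [← h, E.cole] at hc
  cases hc

lemma Emb.edge (E : Emb σm αm col e φ τ s) (x : Fin m) : col x = true ∨ col (αm x) = true := by
  cases h : col x with
  | true => exact Or.inl rfl
  | false =>
    obtain ⟨d, hd, rfl⟩ := E.surjW _ h
    rw [E.invol]
    exact Or.inr (E.cole d)

lemma Emb.sc (E : Emb σm αm col e φ τ s) (x y : Fin N) :
    φ.SameCycle x y ↔ σm.SameCycle (e x) (e y) := by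
  constructor
  · intro h
    refine sc_closed (P := fun y => σm.SameCycle (e x) (e y)) ?_ h (SameCycle.refl _ _)
    intro z hz
    rw [← E.σe]
    exact hz.trans (sc_step _ _)
  · intro h
    obtain ⟨y', h1, h2⟩ := sc_closed (P := fun z => ∃ y', e y' = z ∧ φ.SameCycle x y')
      (by
        rintro z ⟨y', rfl, h2⟩
        exact ⟨φ y', (E.σe _).symm, h2.trans (sc_step _ _)⟩) h ⟨x, rfl, SameCycle.refl _ _⟩
    rwa [← E.inj h1]

lemma Emb.scW (E : Emb σm αm col e φ τ s) (x y : Fin N) (hx : s x = -1) :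
    τ.SameCycle x y ↔ σm.SameCycle (αm (e x)) (αm (e y)) := by
  constructor
  · intro h
    refine (sc_closed (P := fun y => s y = -1 ∧ σm.SameCycle (αm (e x)) (αm (e y))) ?_ h
      ⟨hx, SameCycle.refl _ _⟩).2
    rintro z ⟨h1, hz⟩
    rw [← E.eWσ z h1, E.sτ]
    exact ⟨h1, hz.trans (sc_step _ _)⟩
  · intro h
    obtain ⟨y', h1, h2, h3⟩ := sc_closed (P := fun z => ∃ y', αm (e y') = z ∧ s y' = -1 ∧ τ.SameCycle x y')
      (by
        rintro z ⟨y', rfl, h2, h3⟩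
        exact ⟨τ y', (E.eWσ _ h2).symm, by rw [E.sτ, h2], h3.trans (sc_step _ _)⟩) h
      ⟨x, rfl, hx, SameCycle.refl _ _⟩
    rwa [← E.winj h1]

lemma Emb.period (E : Emb σm αm col e φ τ s) (x : Fin N) :
    Function.minimalPeriod σm (e x) = Function.minimalPeriod φ x := by
  rw [Function.minimalPeriod_eq_minimalPeriod_iff]
  intro k
  have h : Function.Semiconj e φ σm := fun d => (E.σe d).symm
  have h2 : (⇑σm)^[k] (e x) = e ((⇑φ)^[k] x) := ((h.iterate_right k) x).symm
  unfold Function.IsPeriodicPt Function.IsFixedPt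
  rw [h2]
  exact E.inj.eq_iff

lemma Emb.ccB (E : Emb σm αm col e φ τ s) (k : ℕ) :
    cycleCountOn φ (fun x => Function.minimalPeriod φ x = k) =
    cycleCountOn σm (fun x => col x = true ∧ Function.minimalPeriod σm x = k) := by
  refine cc_congr (fun x _ => e x) ?_ ?_ ?_
  · intro x hx
    exact ⟨E.cole x, by rw [E.period]; exact hx⟩
  · intro x _ y _
    exact E.sc x y
  · rintro y ⟨h1, h2⟩
    obtain ⟨d, rfl⟩ := (E.col_iff _).1 h1
    exact ⟨d, by rw [← E.period]; exact h2, SameCycle.refl _ _⟩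

lemma Emb.ccT (E : Emb σm αm col e φ τ s) :
    cycleCount φ = cycleCountOn σm (fun x => col x = true) := by
  refine cc_congr (fun x _ => e x) ?_ ?_ ?_
  · intro x hx
    exact E.cole x
  · intro x _ y _
    exact E.sc x y
  · rintro y h1
    obtain ⟨d, rfl⟩ := (E.col_iff _).1 h1
    exact ⟨d, trivial, SameCycle.refl _ _⟩

lemma Emb.ccW (E : Emb σm αm col e φ τ s) :
    cycleCountOn τ (fun x => s x = -1) = cycleCountOn σm (fun x => col x = false) := by
  refine cc_congr (fun x _ => αm (e x)) ?_ ?_ ?_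
  · intro x hx
    exact E.eW x hx
  · intro x hx y _
    exact E.scW x y hx
  · rintro y h1
    obtain ⟨d, hd, rfl⟩ := E.surjW _ h1
    exact ⟨d, hd, SameCycle.refl _ _⟩

lemma Emb.ccAll (E : Emb σm αm col e φ τ s) :
    cycleCount σm = cycleCount φ + cycleCountOn τ (fun x => s x = -1) := by
  rw [← cc_split (P := fun x => col x = true) (fun x hx => by rw [E.colσ]; exact hx), E.ccT, E.ccW]
  simp only [Bool.not_eq_true]

lemma Emb.card (E : Emb σm αm col e φ τ s) : m = N + Nat.card {d // s d = -1} := by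
  have : Nat.card (Fin N ⊕ {d // s d = -1}) = Nat.card (Fin m) := by
    refine Nat.card_congr (Equiv.ofBijective (Sum.elim e (fun d => αm (e d.1))) ⟨?_, ?_⟩)
    · rintro (x | x) (y | y) h
      · simp only [Sum.elim_inl] at h; rw [E.inj h]
      · simp only [Sum.elim_inl, Sum.elim_inr] at h
        have := E.eW _ y.2
        rw [← h, E.cole] at this; cases this
      · simp only [Sum.elim_inl, Sum.elim_inr] at h
        have := E.eW _ x.2
        rw [h, E.cole] at this; cases this
      · simp only [Sum.elim_inr] at h
        rw [Subtype.ext (E.winj h)]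
    · intro y
      cases h : col y with
      | true =>
        obtain ⟨d, rfl⟩ := (E.col_iff _).1 h
        exact ⟨Sum.inl d, rfl⟩
      | false =>
        obtain ⟨d, hd, rfl⟩ := E.surjW _ h
        exact ⟨Sum.inr ⟨d, hd⟩, rfl⟩
  rw [Nat.card_sum, Nat.card_fin, Nat.card_fin] at this
  exact this.symm

lemma Emb.cardL (E : Emb σm αm col e φ τ s) :
    Nat.card {x // αm x = x} = Nat.card {d // s d = 1} := by
  refine (Nat.card_congr (Equiv.ofBijective
    (fun d : {d // s d = 1} => (⟨e d.1, E.eL _ d.2⟩ : {x // αm x = x})) ⟨?_, ?_⟩)).symm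
  · intro x y h
    exact Subtype.ext (E.inj (congrArg Subtype.val h))
  · rintro ⟨y, hy⟩
    obtain ⟨d, rfl⟩ := (E.col_iff _).1 (E.fixcol _ hy)
    exact ⟨⟨d, (E.leg d).1 hy⟩, rfl⟩

lemma Emb.nonleg (E : Emb σm αm col e φ τ s)
    (h : Nat.card {d // s d = 1} = Nat.card {d // s d = -1}) :
    Nat.card {x // αm x ≠ x} = N := by
  classical
  have h1 := E.card
  have h2 := E.cardL
  have h3 : Nat.card {x // αm x = x} + Nat.card {x // αm x ≠ x} = m := by
    rw [← Nat.card_sum, Nat.card_congr (Equiv.sumCompl (fun x => αm x = x)), Nat.card_fin]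
  omega

lemma Emb.balL (E : Emb σm αm col e φ τ s) (v : Fin N) :
    Nat.card {x // σm.SameCycle (e v) x ∧ αm x = x} =
    Nat.card {d // φ.SameCycle v d ∧ s d = 1} := by
  refine (Nat.card_congr (Equiv.ofBijective
    (fun d : {d // φ.SameCycle v d ∧ s d = 1} =>
      (⟨e d.1, (E.sc _ _).1 d.2.1, E.eL _ d.2.2⟩ : {x // σm.SameCycle (e v) x ∧ αm x = x})) ⟨?_, ?_⟩)).symm
  · intro x y h
    exact Subtype.ext (E.inj (congrArg Subtype.val h))
  · rintro ⟨y, hy, hy2⟩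
    obtain ⟨d, rfl⟩ := (E.col_iff _).1 (E.fixcol _ hy2)
    exact ⟨⟨d, (E.sc _ _).2 hy, (E.leg d).1 hy2⟩, rfl⟩

lemma Emb.balW (E : Emb σm αm col e φ τ s) (v : Fin N) :
    Nat.card {x // σm.SameCycle (e v) x ∧ αm x ≠ x ∧ col (αm x) = false} =
    Nat.card {d // φ.SameCycle v d ∧ s d = -1} := by
  refine (Nat.card_congr (Equiv.ofBijective
    (fun d : {d // φ.SameCycle v d ∧ s d = -1} =>
      (⟨e d.1, (E.sc _ _).1 d.2.1, fun h => by
          have := (E.leg _).1 h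
          have := d.2.2
          omega, E.eW _ d.2.2⟩ :
        {x // σm.SameCycle (e v) x ∧ αm x ≠ x ∧ col (αm x) = false})) ⟨?_, ?_⟩)).symm
  · intro x y h
    exact Subtype.ext (E.inj (congrArg Subtype.val h))
  · rintro ⟨y, hy, hy1, hy2⟩
    have hc : col y = true := by
      rw [inv_of_step E.colσ hy, E.cole]
    obtain ⟨d, rfl⟩ := (E.col_iff _).1 hc
    exact ⟨⟨d, (E.sc _ _).2 hy, (E.white d).1 hy2⟩, rfl⟩

lemma Emb.trs (E : Emb σm αm col e φ τ s) : Trs σm αm ↔ Trs φ τ := by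
  constructor
  · rintro h Q ⟨q, hq⟩ h1 h2 d
    have := h (fun y => (∃ d, Q d ∧ e d = y) ∨ (∃ d, Q d ∧ s d = -1 ∧ αm (e d) = y))
      ⟨e q, Or.inl ⟨q, hq, rfl⟩⟩ ?_ ?_ (e d)
    · rcases this with ⟨d', h, h'⟩ | ⟨d', h, h', h''⟩
      · rwa [← E.inj h']
      · have := E.eW _ h'
        rw [h'', E.cole] at this; cases this
    · rintro x (⟨d, h, rfl⟩ | ⟨d, h, h', rfl⟩)
      · exact Or.inl ⟨φ d, h1 _ h, (E.σe d).symm⟩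
      · exact Or.inr ⟨τ d, h2 _ h, by rw [E.sτ, h'], (E.eWσ d h').symm⟩
    · rintro x (⟨d, h, rfl⟩ | ⟨d, h, h', rfl⟩)
      · rcases E.s3 d with h3 | h3 | h3
        · exact Or.inr ⟨d, h, h3, rfl⟩
        · exact Or.inl ⟨τ d, h2 _ h, (E.eB d h3).symm⟩
        · exact Or.inl ⟨d, h, (E.eL d h3).symm⟩
      · exact Or.inl ⟨d, h, (E.invol _).symm⟩
  · rintro h P ⟨y, hy⟩ h1 h2
    have hall : ∀ d, P (e d) := by
      refine h (fun d => P (e d)) ?_ ?_ ?_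
      · cases hc : col y with
        | true =>
          obtain ⟨d, rfl⟩ := (E.col_iff _).1 hc
          exact ⟨d, hy⟩
        | false =>
          obtain ⟨d, hd, rfl⟩ := E.surjW _ hc
          have := h2 _ hy
          rw [E.invol] at this
          exact ⟨d, this⟩
      · intro x hx
        show P (e (φ x))
        rw [← E.σe]; exact h1 _ hx
      · intro x hx
        show P (e (τ x))
        rcases E.s3 x with h3 | h3 | h3
        · have := h2 _ (h1 _ (h2 _ hx))
          rwa [E.eWσ x h3, E.invol] at this
        · rw [← E.eB x h3]; exact h2 _ hx
        · rw [E.τL x h3]; exact hx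
    intro z
    cases hc : col z with
    | true =>
      obtain ⟨d, rfl⟩ := (E.col_iff _).1 hc
      exact hall d
    | false =>
      obtain ⟨d, hd, rfl⟩ := E.surjW _ hc
      exact h2 _ (hall d)

lemma Emb.cardLW (E : Emb σm αm col e φ τ s)
    (bal : ∀ v, Nat.card {x // φ.SameCycle v x ∧ s x = 1} =
      Nat.card {x // φ.SameCycle v x ∧ s x = -1}) :
    Nat.card {d // s d = 1} = Nat.card {d // s d = -1} := by
  obtain ⟨g, hg⟩ := exists_potential E.s3 bal
  exact card_of_potential E.s3 hg

lemma Emb.bal_of (E : Emb σm αm col e φ τ s) (M : IsMobile σm αm col) (v : Fin N) :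
    Nat.card {x // φ.SameCycle v x ∧ s x = 1} = Nat.card {x // φ.SameCycle v x ∧ s x = -1} := by
  obtain ⟨-, -, -, -, -, -, h⟩ := M
  have := h (e v) (E.cole v)
  rwa [E.balL, E.balW] at this

lemma Emb.size (E : Emb σm αm col e φ τ s) (M : IsMobile σm αm col) :
    Nat.card {x // αm x ≠ x} = N := E.nonleg (E.cardLW (E.bal_of M))

lemma Emb.rm {n : ℕ} (E : Emb σm αm col e φ τ s) (M : IsMobile σm αm col) (hN : N = 2 * n) : RM φ τ s where
  s3 := E.s3
  τL := E.τL
  τB := E.τB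
  sτ := E.sτ
  trs := E.trs.1 ((trs_iff _ _).1 M.2.2.2.2.1)
  tree := by
    have h1 := E.size M
    have h2 := M.2.2.2.2.2.1
    rw [h1, E.ccAll] at h2
    omega
  bal := E.bal_of M

lemma Emb.mobile (E : Emb σm αm col e φ τ s) (R : RM φ τ s) : IsMobile σm αm col := by
  refine ⟨E.colσ, E.invol, E.fixcol, fun x _ => E.edge x, (trs_iff _ _).2 (E.trs.2 R.trs), ?_, ?_⟩
  · have h1 := E.nonleg (E.cardLW R.bal)
    have h2 := R.tree
    rw [h1, E.ccAll]
    omega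
  · intro v hv
    obtain ⟨d, rfl⟩ := (E.col_iff _).1 hv
    rw [E.balL, E.balW]
    exact R.bal d

end

/-- forward existence -/
lemma exists_emb {m : ℕ} {σm αm : Perm (Fin m)} {col : Fin m → Bool} (M : IsMobile σm αm col) :
    ∃ (N : ℕ) (e : Fin N → Fin m) (φ τ : Perm (Fin N)) (s : Fin N → ℤ), Emb σm αm col e φ τ s := by
  classical
  obtain ⟨hc, hα, hfix, hedge, -, -, -⟩ := M
  let N := Nat.card {y // col y = true}
  let u : Fin N ≃ {y // col y = true} := (Finite.equivFin _).symm
  let e : Fin N → Fin m := fun d => (u d).1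
  have inj : Function.Injective e := fun x y h => u.injective (Subtype.ext h)
  have ecol : ∀ d, col (e d) = true := fun d => (u d).2
  have ex : ∀ y, col y = true → ∃ d, e d = y := fun y hy => ⟨u.symm ⟨y, hy⟩, by simp [e]⟩
  have hcf : ∀ y, col y = false → col (αm y) = true := by
    intro y hy
    have h1 : αm y ≠ y := fun h => by rw [hfix y h] at hy; cases hy
    rcases hedge y h1 with h | h
    · rw [h] at hy; cases hy
    · exact h
  choose F hF using fun d => ex (σm (e d)) (by rw [hc, ecol])
  have Finj : Function.Injective F := by
    intro x y h
    have := congrArg e h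
    rw [hF, hF] at this
    exact inj (σm.injective this)
  let s : Fin N → ℤ := fun d => if αm (e d) = e d then 1 else if col (αm (e d)) = true then 0 else -1
  have s1 : ∀ d, s d = 1 ↔ αm (e d) = e d := by
    intro d; simp only [s]; split_ifs <;> simp_all
  have s0 : ∀ d, s d = 0 ↔ αm (e d) ≠ e d ∧ col (αm (e d)) = true := by
    intro d; simp only [s]; split_ifs <;> simp_all
  have sW : ∀ d, s d = -1 ↔ col (αm (e d)) = false := by
    intro d; simp only [s]; split_ifs with h1 h2
    · rw [h1, ecol]; norm_num
    · simp [h2]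
    · simp at h2; simp [h2]
  have s3 : ∀ x, s x = -1 ∨ s x = 0 ∨ s x = 1 := by
    intro d; simp only [s]; split_ifs <;> simp
  have hT' : ∀ d, ∃ d', (s d = 1 → d' = d) ∧ (s d = 0 → e d' = αm (e d)) ∧
      (s d = -1 → αm (e d') = σm (αm (e d))) := by
    intro d
    rcases s3 d with h | h | h
    · obtain ⟨d', h'⟩ := ex (αm (σm (αm (e d)))) (hcf _ (by rw [hc]; exact (sW d).1 h))
      exact ⟨d', by omega, by omega, fun _ => by rw [h', hα]⟩
    · obtain ⟨d', h'⟩ := ex (αm (e d)) ((s0 d).1 h).2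
      exact ⟨d', by omega, fun _ => h', by omega⟩
    · exact ⟨d, fun _ => rfl, by omega, by omega⟩
  choose T hT1 hT0 hTW using hT'
  have sT : ∀ d, s (T d) = s d := by
    intro d
    rcases s3 d with h | h | h
    · rw [h, sW, hTW d h, hc]; exact (sW d).1 h
    · rw [h, s0, hT0 d h, hα]; exact ⟨fun h' => ((s0 d).1 h).1 h'.symm, ecol d⟩
    · rw [hT1 d h]
  have Tinj : Function.Injective T := by
    intro x y h
    have hs : s x = s y := by rw [← sT x, h, sT]
    rcases s3 x with h1 | h1 | h1
    · have h2 := hTW x h1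
      rw [h, hTW y (by omega)] at h2
      exact (inj (αm.injective (σm.injective h2))).symm
    · have h2 := hT0 x h1
      rw [h, hT0 y (by omega)] at h2
      exact (inj (αm.injective h2)).symm
    · rw [← hT1 x h1, h, hT1 y (by omega)]
  refine ⟨N, e, Equiv.ofBijective F (Finite.injective_iff_bijective.1 Finj),
    Equiv.ofBijective T (Finite.injective_iff_bijective.1 Tinj), s, ?_⟩
  exact {
    inj := inj
    col_iff := fun y => ⟨ex y, by rintro ⟨d, rfl⟩; exact ecol d⟩
    σe := fun d => (hF d).symm
    invol := hα
    s3 := s3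
    eL := fun d => (s1 d).1
    eB := fun d h => (hT0 d h).symm
    eW := fun d => (sW d).1
    eWσ := fun d h => (hTW d h).symm
    surjW := by
      intro y hy
      obtain ⟨d, hd⟩ := ex (αm y) (hcf y hy)
      have : αm (e d) = y := by rw [hd, hα]
      exact ⟨d, (sW d).2 (by rw [this]; exact hy), this⟩
    τL := hT1
    τB := fun x h => by
      show T x ≠ x ∧ T (T x) = x
      have h1 := hT0 x h
      refine ⟨fun h' => ((s0 x).1 h).1 (by rw [← h1, h']), inj ?_⟩
      rw [hT0 _ (by rw [sT, h]), h1, hα]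
    sτ := sT }

/-- backward existence -/
lemma exists_mobile {N : ℕ} {φ τ : Perm (Fin N)} {s : Fin N → ℤ} (R : RM φ τ s) :
    ∃ (m : ℕ) (σm αm : Perm (Fin m)) (col : Fin m → Bool) (e : Fin N → Fin m),
      Emb σm αm col e φ τ s := by
  classical
  let Z := Fin N ⊕ {d // s d = -1}
  let m := Nat.card Z
  let u : Z ≃ Fin m := Finite.equivFin _
  let σZ : Perm Z := Equiv.sumCongr φ (τ.subtypePerm (p := fun d => s d = -1)
    (fun x => by rw [R.sτ]))
  let A : Z → Z := Sum.elim (fun d => if s d = 1 then Sum.inl d else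
    if h : s d = -1 then Sum.inr ⟨d, h⟩ else Sum.inl (τ d)) (fun d => Sum.inl d.1)
  have A1 : ∀ d, s d = 1 → A (Sum.inl d) = Sum.inl d := fun d h => by simp [A, h]
  have AW : ∀ d (h : s d = -1), A (Sum.inl d) = Sum.inr ⟨d, h⟩ := fun d h => by simp [A, h]
  have A0 : ∀ d, s d = 0 → A (Sum.inl d) = Sum.inl (τ d) := fun d h => by simp [A, h]
  have AR : ∀ d, A (Sum.inr d) = Sum.inl d.1 := fun d => rfl
  have hA : Function.Involutive A := by
    rintro (d | d)
    · rcases R.s3 d with h | h | h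
      · rw [AW d h, AR]
      · rw [A0 d h, A0 _ (by rw [R.sτ, h]), (R.τB d h).2]
      · rw [A1 d h, A1 d h]
    · rw [AR, AW _ d.2]
  let αZ : Perm Z := hA.toPerm A
  have αe : ∀ d, u.permCongr αZ (u (Sum.inl d)) = u (A (Sum.inl d)) := fun d => by
    rw [Equiv.permCongr_apply, Equiv.symm_apply_apply]; rfl
  refine ⟨m, u.permCongr σZ, u.permCongr αZ, fun y => (u.symm y).isLeft,
    fun d => u (Sum.inl d), ?_⟩
  exact {
    inj := fun x y h => Sum.inl_injective (u.injective h)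
    col_iff := by
      intro y
      constructor
      · intro h
        obtain ⟨d, hd⟩ := Sum.isLeft_iff.1 h
        exact ⟨d, by rw [← hd, Equiv.apply_symm_apply]⟩
      · rintro ⟨d, rfl⟩
        simp
    σe := fun d => by
      rw [Equiv.permCongr_apply, Equiv.symm_apply_apply]; rfl
    invol := fun y => by
      rw [Equiv.permCongr_apply, Equiv.permCongr_apply, Equiv.symm_apply_apply]
      show u (A (A (u.symm y))) = y
      rw [hA, Equiv.apply_symm_apply]
    s3 := R.s3
    eL := fun d h => by rw [αe, A1 d h]
    eB := fun d h => by rw [αe, A0 d h]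
    eW := fun d h => by rw [αe, AW d h]; simp
    eWσ := fun d h => by
      rw [αe, αe, AW d h, AW (τ d) (by rw [R.sτ, h]), Equiv.permCongr_apply, Equiv.symm_apply_apply]
      rfl
    surjW := by
      intro y hy
      have hy' : (u.symm y).isLeft = false := hy
      cases h : u.symm y with
      | inl d => rw [h] at hy'; simp at hy'
      | inr d =>
        refine ⟨d.1, d.2, ?_⟩
        rw [αe, AW _ d.2]
        show u (Sum.inr d) = y
        rw [← h, Equiv.apply_symm_apply]
    τL := R.τL
    τB := R.τB
    sτ := R.sτ }

section
variable {m m' N : ℕ} {σm αm : Perm (Fin m)} {col : Fin m → Bool} {e : Fin N → Fin m}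
    {φ τ : Perm (Fin N)} {s : Fin N → ℤ} {σm' αm' : Perm (Fin m)} {col' : Fin m → Bool} {e' : Fin N → Fin m}
    {φ' τ' : Perm (Fin N)} {s' : Fin N → ℤ}

lemma Emb.iso_fwd (E : Emb σm αm col e φ τ s) (E' : Emb σm' αm' col' e' φ' τ' s')
    {π : Perm (Fin m)} (h1 : ∀ x, π (σm x) = σm' (π x)) (h2 : ∀ x, π (αm x) = αm' (π x))
    (h3 : ∀ x, col x = col' (π x)) :
    ∃ π' : Perm (Fin N), (∀ d, e' (π' d) = π (e d)) ∧ (∀ x, π' (φ x) = φ' (π' x)) ∧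
      (∀ x, π' (τ x) = τ' (π' x)) ∧ ∀ x, s' (π' x) = s x := by
  choose F hF using fun d => (E'.col_iff (π (e d))).1 (by rw [← h3, E.cole])
  have Finj : Function.Injective F := by
    intro x y h
    have := congrArg e' h
    rw [hF, hF] at this
    exact E.inj (π.injective this)
  have hs : ∀ x, s' (F x) = s x := by
    intro x
    have a1 := E.leg x
    have a2 := E.white x
    have b1 := E'.leg (F x)
    have b2 := E'.white (F x)
    rw [hF, ← h2, π.injective.eq_iff, a1] at b1
    rw [hF, ← h2, ← h3, a2] at b2
    have := E.s3 x
    have := E'.s3 (F x)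
    omega
  refine ⟨Equiv.ofBijective F (Finite.injective_iff_bijective.1 Finj), hF, ?_, ?_, hs⟩
  · intro x
    apply E'.inj
    show e' (F (φ x)) = e' (φ' (F x))
    rw [hF, ← E'.σe, hF, ← E.σe, h1]
  · intro x
    apply E'.inj
    show e' (F (τ x)) = e' (τ' (F x))
    rcases E.s3 x with h | h | h
    · apply αm'.injective
      rw [hF, ← E'.eWσ _ (by rw [hs, h]), hF, ← h2, ← h2, ← h1, E.eWσ x h]
    · rw [hF, ← E'.eB _ (by rw [hs, h]), hF, ← h2, E.eB x h]
    · rw [E.τL x h, E'.τL _ (by rw [hs, h])]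

lemma Emb.iso_bwd (E : Emb σm αm col e φ τ s) (E' : Emb σm' αm' col' e' φ' τ' s')
    {π' : Perm (Fin N)} (h1 : ∀ x, π' (φ x) = φ' (π' x))
    (h2 : ∀ x, π' (τ x) = τ' (π' x)) (h3 : ∀ x, s' (π' x) = s x) :
    ∃ π : Perm (Fin m), (∀ d, e' (π' d) = π (e d)) ∧ (∀ x, π (σm x) = σm' (π x)) ∧
      (∀ x, π (αm x) = αm' (π x)) ∧ ∀ x, col x = col' (π x) := by
  have hex : ∀ y, ∃ y', (∀ d, e d = y → y' = e' (π' d)) ∧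
      (∀ d, s d = -1 → αm (e d) = y → y' = αm' (e' (π' d))) := by
    intro y
    cases hc : col y with
    | true =>
      obtain ⟨d, rfl⟩ := (E.col_iff _).1 hc
      refine ⟨e' (π' d), fun d' h => by rw [E.inj h], fun d' h h' => ?_⟩
      rw [← h', E.eW _ h] at hc; cases hc
    | false =>
      obtain ⟨d, hd, rfl⟩ := E.surjW _ hc
      refine ⟨αm' (e' (π' d)), fun d' h => ?_, fun d' h h' => by rw [E.winj h']⟩
      rw [← h, E.cole] at hc; cases hc
  choose F hB hW using hex
  have hB' : ∀ d, F (e d) = e' (π' d) := fun d => hB _ d rfl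
  have hW' : ∀ d, s d = -1 → F (αm (e d)) = αm' (e' (π' d)) := fun d h => hW _ d h rfl
  have hcol : ∀ x, col x = col' (F x) := by
    intro y
    cases hc : col y with
    | true =>
      obtain ⟨d, rfl⟩ := (E.col_iff _).1 hc
      rw [hB', E'.cole]
    | false =>
      obtain ⟨d, hd, rfl⟩ := E.surjW _ hc
      rw [hW' d hd, E'.eW _ (by rw [h3, hd])]
  have Finj : Function.Injective F := by
    intro x y h
    have hxy : col x = col y := by rw [hcol, h, hcol]
    cases hc : col x with
    | true =>
      rw [hc] at hxy
      obtain ⟨d, rfl⟩ := (E.col_iff _).1 hc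
      obtain ⟨d', rfl⟩ := (E.col_iff _).1 hxy.symm
      rw [hB', hB'] at h
      rw [π'.injective (E'.inj h)]
    | false =>
      rw [hc] at hxy
      obtain ⟨d, hd, rfl⟩ := E.surjW _ hc
      obtain ⟨d', hd', rfl⟩ := E.surjW _ hxy.symm
      rw [hW' d hd, hW' d' hd'] at h
      rw [π'.injective (E'.winj h)]
  refine ⟨Equiv.ofBijective F (Finite.injective_iff_bijective.1 Finj), fun d => (hB' d).symm,
    ?_, ?_, hcol⟩
  · intro y
    show F (σm y) = σm' (F y)
    cases hc : col y with
    | true =>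
      obtain ⟨d, rfl⟩ := (E.col_iff _).1 hc
      rw [E.σe, hB', hB', h1, E'.σe]
    | false =>
      obtain ⟨d, hd, rfl⟩ := E.surjW _ hc
      rw [E.eWσ d hd, hW' _ (by rw [E.sτ, hd]), hW' d hd, h2, E'.eWσ _ (by rw [h3, hd])]
  · intro y
    show F (αm y) = αm' (F y)
    cases hc : col y with
    | true =>
      obtain ⟨d, rfl⟩ := (E.col_iff _).1 hc
      rcases E.s3 d with h | h | h
      · rw [hW' d h, hB']
      · rw [E.eB d h, hB', hB', h2, E'.eB _ (by rw [h3, h])]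
      · rw [E.eL d h, hB', E'.eL _ (by rw [h3, h])]
    | false =>
      obtain ⟨d, hd, rfl⟩ := E.surjW _ hc
      rw [E.invol, hB', hW' d hd, E'.invol]

end

lemma Emb.size_eq {m m' N : ℕ} {σm αm : Perm (Fin m)} {col : Fin m → Bool} {e : Fin N → Fin m}
    {φ τ : Perm (Fin N)} {s : Fin N → ℤ} {σm' αm' : Perm (Fin m')} {col' : Fin m' → Bool}
    {e' : Fin N → Fin m'} {φ' τ' : Perm (Fin N)} {s' : Fin N → ℤ}
    (E : Emb σm αm col e φ τ s) (E' : Emb σm' αm' col' e' φ' τ' s')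
    (π' : Perm (Fin N)) (h3 : ∀ x, s' (π' x) = s x) : m = m' := by
  rw [E.card, E'.card, Nat.card_congr (π'.subtypeEquiv (p := fun d => s d = -1)
    (q := fun d => s' d = -1) (fun x => by rw [h3]))]

end BDG
set_option linter.all false
namespace BDG
open Equiv Equiv.Perm

structure K {n m : ℕ} (σm αm : Perm (Fin m)) (col : Fin m → Bool) (σ α : Perm (Fin (2 * n)))
    (p : Fin (2 * n)) (e : Fin (2 * n) → Fin m) (τ : Perm (Fin (2 * n))) (s ℓ : Fin (2 * n) → ℤ) :
    Prop where
  E : Emb σm αm col e (σ * α) τ s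
  G : Good (σ * α) τ α s ℓ p

lemma mulmul {X : Type*} {σ α : Perm X} (h : ∀ x, α (α x) = x) : σ * α * α = σ := by
  ext x; simp [h]

lemma K_fwd {n m a : ℕ} {f : ℕ → ℕ} {σm αm : Perm (Fin m)} {col : Fin m → Bool}
    (M : IsMobile σm αm col) (S : MobileStats σm αm col n a f) :
    ∃ (σ α : Perm (Fin (2 * n))) (p : Fin (2 * n)) (e : Fin (2 * n) → Fin m)
      (τ : Perm (Fin (2 * n))) (s ℓ : Fin (2 * n) → ℤ), K σm αm col σ α p e τ s ℓ ∧
      IsPlanarMap σ α ∧ PointedMapStats σ α p a f := by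
  obtain ⟨N, e, φ, τ, s, E⟩ := exists_emb M
  have hN : N = 2 * n := by rw [← E.size M]; exact S.1
  subst hN
  have R := E.rm M rfl
  obtain ⟨α, ℓ, p, G⟩ := exists_good_of_rm R
  have hφ : φ * α * α = φ := mulmul G.hα
  refine ⟨φ * α, α, p, e, τ, s, ℓ, ⟨by rw [hφ]; exact E, by rw [hφ]; exact G⟩,
    ⟨G.hα, G.ne, (trs_iff _ _).2 G.trs_map, ?_⟩, ?_, ?_⟩
  · rw [hφ, G.countσ]
    have := R.tree
    omega
  · rw [← G.count, E.ccW]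
    exact S.2.1
  · intro k
    rw [hφ, E.ccB]
    exact S.2.2 k

lemma K_bwd {n a : ℕ} {f : ℕ → ℕ} {σ α : Perm (Fin (2 * n))} {p : Fin (2 * n)}
    (M : IsPlanarMap σ α) (S : PointedMapStats σ α p a f) :
    ∃ (m : ℕ) (σm αm : Perm (Fin m)) (col : Fin m → Bool) (e : Fin (2 * n) → Fin m)
      (τ : Perm (Fin (2 * n))) (s ℓ : Fin (2 * n) → ℤ), K σm αm col σ α p e τ s ℓ ∧
      IsMobile σm αm col ∧ (∃ x, col x = true) ∧ MobileStats σm αm col n a f := by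
  obtain ⟨hα, hne, ht, hc⟩ := M
  obtain ⟨τ, s, ℓ, G⟩ := exists_good_of_map p hα hne ((trs_iff _ _).1 ht)
  have hσ : σ * α * α = σ := mulmul hα
  have R := G.rm (by rw [hσ]; omega)
  obtain ⟨m, σm, αm, col, e, E⟩ := exists_mobile R
  refine ⟨m, σm, αm, col, e, τ, s, ℓ, ⟨E, G⟩, E.mobile R, ⟨e p, E.cole p⟩,
    E.nonleg (E.cardLW R.bal), ?_, ?_⟩
  · rw [← E.ccW, G.count, hσ]
    exact S.1
  · intro k
    rw [← E.ccB]
    exact S.2 k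

section
variable {n m : ℕ} {σm αm : Perm (Fin m)} {col : Fin m → Bool} {σ α : Perm (Fin (2 * n))}
    {p : Fin (2 * n)} {e : Fin (2 * n) → Fin m} {τ : Perm (Fin (2 * n))} {s ℓ : Fin (2 * n) → ℤ}
    {σm' αm' : Perm (Fin m)} {col' : Fin m → Bool} {σ' α' : Perm (Fin (2 * n))}
    {p' : Fin (2 * n)} {e' : Fin (2 * n) → Fin m} {τ' : Perm (Fin (2 * n))}
    {s' ℓ' : Fin (2 * n) → ℤ}

lemma K_iso_fwd (k : K σm αm col σ α p e τ s ℓ) (k' : K σm' αm' col' σ' α' p' e' τ' s' ℓ')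
    {π : Perm (Fin m)} (h1 : π * σm * π⁻¹ = σm') (h2 : π * αm * π⁻¹ = αm')
    (h3 : ∀ x, col x = col' (π x)) :
    ∃ π' : Perm (Fin (2 * n)), (∀ d, e' (π' d) = π (e d)) ∧ (∀ x, s' (π' x) = s x) ∧
      π' * σ * π'⁻¹ = σ' ∧ π' * α * π'⁻¹ = α' ∧ σ'.SameCycle (π' p) p' := by
  obtain ⟨π', he, hφ, hτ, hs⟩ := k.E.iso_fwd k'.E (conj_iff.1 h1) (conj_iff.1 h2) h3
  have C := k.G.conj π'
  have e1 : π' * (σ * α) * π'⁻¹ = σ' * α' := conj_iff.2 hφ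
  have e2 : π' * τ * π'⁻¹ = τ' := conj_iff.2 hτ
  have e3 : (fun x => s (π'⁻¹ x)) = s' := by
    funext x
    have := hs (π'⁻¹ x)
    rw [app_inv] at this
    exact this.symm
  rw [e1, e2, e3] at C
  obtain ⟨u1, u2⟩ := k'.G.unique_map C
  rw [mulmul k'.G.hα] at u2
  refine ⟨π', he, hs, ?_, u1, u2.symm⟩
  have : π' * σ * π'⁻¹ = (π' * (σ * α) * π'⁻¹) * (π' * α * π'⁻¹) := by
    have := mulmul (σ := σ) k.G.hα
    conv_lhs => rw [← this]
    group
  rw [this, e1, u1, mulmul k'.G.hα]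

end

lemma K_mob {n m m' : ℕ} {σm αm : Perm (Fin m)} {col : Fin m → Bool} {σ α : Perm (Fin (2 * n))}
    {p : Fin (2 * n)} {e : Fin (2 * n) → Fin m} {τ : Perm (Fin (2 * n))} {s ℓ : Fin (2 * n) → ℤ}
    {σm' αm' : Perm (Fin m')} {col' : Fin m' → Bool} {σ' α' : Perm (Fin (2 * n))}
    {p' : Fin (2 * n)} {e' : Fin (2 * n) → Fin m'} {τ' : Perm (Fin (2 * n))}
    {s' ℓ' : Fin (2 * n) → ℤ}
    (k : K σm αm col σ α p e τ s ℓ) (k' : K σm' αm' col' σ' α' p' e' τ' s' ℓ')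
    {π' : Perm (Fin (2 * n))} (h1 : π' * σ * π'⁻¹ = σ') (h2 : π' * α * π'⁻¹ = α')
    (h3 : σ'.SameCycle (π' p) p') :
    (∀ x, π' ((σ * α) x) = (σ' * α') (π' x)) ∧ (∀ x, π' (τ x) = τ' (π' x)) ∧
      ∀ x, s' (π' x) = s x := by
  have C := k.G.conj π'
  have e1 : π' * (σ * α) * π'⁻¹ = σ' * α' := by rw [← h1, ← h2]; group
  rw [e1, h2] at C
  obtain ⟨u1, u2⟩ := k'.G.unique_mob C (by rw [mulmul k'.G.hα]; exact h3.symm)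
  refine ⟨conj_iff.1 e1, conj_iff.1 u2, fun x => ?_⟩
  rw [← u1]
  simp

section
variable {n m : ℕ} {σm αm : Perm (Fin m)} {col : Fin m → Bool} {σ α : Perm (Fin (2 * n))}
    {p : Fin (2 * n)} {e : Fin (2 * n) → Fin m} {τ : Perm (Fin (2 * n))} {s ℓ : Fin (2 * n) → ℤ}
    {σm' αm' : Perm (Fin m)} {col' : Fin m → Bool} {σ' α' : Perm (Fin (2 * n))}
    {p' : Fin (2 * n)} {e' : Fin (2 * n) → Fin m} {τ' : Perm (Fin (2 * n))}
    {s' ℓ' : Fin (2 * n) → ℤ}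

lemma K_iso_bwd (k : K σm αm col σ α p e τ s ℓ) (k' : K σm' αm' col' σ' α' p' e' τ' s' ℓ')
    {π' : Perm (Fin (2 * n))} (h1 : π' * σ * π'⁻¹ = σ') (h2 : π' * α * π'⁻¹ = α')
    (h3 : σ'.SameCycle (π' p) p') :
    ∃ π : Perm (Fin m), (∀ d, e' (π' d) = π (e d)) ∧ (∀ x, s' (π' x) = s x) ∧
      π * σm * π⁻¹ = σm' ∧ π * αm * π⁻¹ = αm' ∧ ∀ x, col x = col' (π x) := by
  obtain ⟨u1, u2, u3⟩ := K_mob k k' h1 h2 h3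
  obtain ⟨π, he, v1, v2, v3⟩ := k.E.iso_bwd k'.E u1 u2 u3
  exact ⟨π, he, u3, conj_iff.2 v1, conj_iff.2 v2, v3⟩

def Rt {n m : ℕ} (αm : Perm (Fin m)) (α : Perm (Fin (2 * n))) (e : Fin (2 * n) → Fin m)
    (s : Fin (2 * n) → ℤ) (x : Fin m) (d : Fin (2 * n)) : Prop :=
  (s d ≠ 1 ∧ x = e d) ∨ (s d = 1 ∧ x = αm (e (α d)))

lemma K.Rt_ex (k : K σm αm col σ α p e τ s ℓ) (d : Fin (2 * n)) : ∃ x, αm x ≠ x ∧ Rt αm α e s x d := by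
  by_cases h : s d = 1
  · refine ⟨αm (e (α d)), fun h' => ?_, Or.inr ⟨h, rfl⟩⟩
    have h1 := k.E.eW (α d) (by rw [k.G.sα, h])
    rw [k.E.fixcol _ h'] at h1
    cases h1
  · exact ⟨e d, fun h' => h ((k.E.leg d).1 h'), Or.inl ⟨h, rfl⟩⟩

lemma K.Rt_ex' (k : K σm αm col σ α p e τ s ℓ) (x : Fin m) (hx : αm x ≠ x) : ∃ d, Rt αm α e s x d := by
  cases hc : col x with
  | true =>
    obtain ⟨d, rfl⟩ := (k.E.col_iff _).1 hc
    exact ⟨d, Or.inl ⟨fun h => hx (k.E.eL d h), rfl⟩⟩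
  | false =>
    obtain ⟨d, hd, rfl⟩ := k.E.surjW _ hc
    exact ⟨α d, Or.inr ⟨by rw [k.G.sα, hd]; norm_num, by rw [k.G.hα]⟩⟩

lemma K.Rt_fun {x y : Fin m} {d : Fin (2 * n)} (h : Rt αm α e s x d) (h' : Rt αm α e s y d) : x = y := by
  rcases h with ⟨h1, rfl⟩ | ⟨h1, rfl⟩ <;> rcases h' with ⟨h2, rfl⟩ | ⟨h2, rfl⟩
  · rfl
  · exact absurd h2 h1
  · exact absurd h1 h2
  · rfl

lemma K.Rt_inj (k : K σm αm col σ α p e τ s ℓ) {x : Fin m} {d d' : Fin (2 * n)}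
    (h : Rt αm α e s x d) (h' : Rt αm α e s x d') : d = d' := by
  rcases h with ⟨h1, rfl⟩ | ⟨h1, rfl⟩ <;> rcases h' with ⟨h2, h3⟩ | ⟨h2, h3⟩
  · exact k.E.inj h3
  · have := k.E.eW (α d') (by rw [k.G.sα, h2])
    rw [← h3, k.E.cole] at this; cases this
  · have := k.E.eW (α d) (by rw [k.G.sα, h1])
    rw [h3, k.E.cole] at this; cases this
  · exact α.injective (k.E.winj h3)

lemma K.Rt_iso (k : K σm αm col σ α p e τ s ℓ) (k' : K σm' αm' col' σ' α' p' e' τ' s' ℓ')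
    {π : Perm (Fin m)} {π' : Perm (Fin (2 * n))} (he : ∀ d, e' (π' d) = π (e d))
    (hs : ∀ x, s' (π' x) = s x) (h2 : π * αm * π⁻¹ = αm') (h2' : π' * α * π'⁻¹ = α')
    {x x' : Fin m} {d d' : Fin (2 * n)} (r : Rt αm α e s x d) (r' : Rt αm' α' e' s' x' d') :
    π x = x' ↔ π' d = d' := by
  have hr : Rt αm' α' e' s' (π x) (π' d) := by
    rcases r with ⟨h1, rfl⟩ | ⟨h1, rfl⟩
    · exact Or.inl ⟨by rw [hs]; exact h1, (he d).symm⟩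
    · refine Or.inr ⟨by rw [hs]; exact h1, ?_⟩
      rw [← conj_iff.1 h2', he, conj_iff.1 h2]
  constructor
  · rintro rfl
    exact k'.Rt_inj hr r'
  · rintro rfl
    exact K.Rt_fun hr r'

end

end BDG
set_option linter.all false
open BDG

/-- **The Bouttier–Di Francesco–Guitter/CFKS bijection, at the level of counts.**
Mobiles with at least one black vertex correspond bijectively to pointed planar maps
(white vertices ↔ non-pointed vertices, black vertices ↔ faces, degrees ↔ valencies,
edges ↔ edges); hence for all `n`, `a`, `f` the counts agree, and likewise in the
rooted case. -/
theorem mobile_pointedMap_count_eq (n a : ℕ) (f : ℕ → ℕ) :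
    mobileCount n a f = pointedMapCount n a f ∧
    rootedMobileCount n a f = rootedPointedMapCount n a f := by
  constructor
  · unfold mobileCount pointedMapCount
    refine count_corr _ (fun m X Y => ∃ e τ s ℓ, K X.1.1 X.1.2.1 X.1.2.2 Y.1.1 Y.1.2.1 Y.1.2.2 e τ s ℓ)
      ?_ ?_ ?_ ?_ ?_ ?_
    · intro m X
      exact ⟨1, by simp, by simp, fun x => rfl⟩
    · intro Y
      exact ⟨1, by simp, by simp, Equiv.Perm.SameCycle.refl _ _⟩
    · rintro m ⟨⟨σm, αm, col⟩, M, hb, S⟩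
      obtain ⟨σ, α, p, e, τ, s, ℓ, k, h1, h2⟩ := K_fwd M S
      exact ⟨⟨(σ, α, p), h1, h2⟩, e, τ, s, ℓ, k⟩
    · rintro ⟨⟨σ, α, p⟩, M, S⟩
      obtain ⟨m, σm, αm, col, e, τ, s, ℓ, k, h1, h2, h3⟩ := K_bwd M S
      exact ⟨m, ⟨(σm, αm, col), h1, h2, h3⟩, e, τ, s, ℓ, k⟩
    · rintro m X Y m' X' Y' ⟨e, τ, s, ℓ, k⟩ ⟨e', τ', s', ℓ', k'⟩ ⟨π, h1, h2, h3⟩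
      exact k.E.size_eq k'.E π (K_mob k k' h1 h2 h3).2.2
    · rintro m X Y X' Y' ⟨e, τ, s, ℓ, k⟩ ⟨e', τ', s', ℓ', k'⟩
      constructor
      · rintro ⟨π, h1, h2, h3⟩
        obtain ⟨π', -, -, g1, g2, g3⟩ := K_iso_fwd k k' h1 h2 h3
        exact ⟨π', g1, g2, g3⟩
      · rintro ⟨π, h1, h2, h3⟩
        obtain ⟨π', -, -, g1, g2, g3⟩ := K_iso_bwd k k' h1 h2 h3
        exact ⟨π', g1, g2, g3⟩
  · unfold rootedMobileCount rootedPointedMapCount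
    refine count_corr _ (fun m X Y => ∃ e τ s ℓ,
        K X.1.1.1 X.1.1.2 X.1.2.1 Y.1.1.1 Y.1.1.2 Y.1.2.1 e τ s ℓ ∧
        Rt X.1.1.2 Y.1.1.2 e s X.1.2.2 Y.1.2.2)
      ?_ ?_ ?_ ?_ ?_ ?_
    · intro m X
      exact ⟨1, by simp, by simp, fun x => rfl, rfl⟩
    · intro Y
      exact ⟨1, by simp, by simp, Equiv.Perm.SameCycle.refl _ _, rfl⟩
    · rintro m ⟨⟨⟨σm, αm⟩, col, x⟩, M, hb, hx, S⟩
      obtain ⟨σ, α, p, e, τ, s, ℓ, k, h1, h2⟩ := K_fwd M S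
      obtain ⟨d, hd⟩ := k.Rt_ex' x hx
      exact ⟨⟨((σ, α), p, d), h1, h2⟩, e, τ, s, ℓ, k, hd⟩
    · rintro ⟨⟨⟨σ, α⟩, p, d⟩, M, S⟩
      obtain ⟨m, σm, αm, col, e, τ, s, ℓ, k, h1, h2, h3⟩ := K_bwd M S
      obtain ⟨x, hx, hd⟩ := k.Rt_ex d
      exact ⟨m, ⟨((σm, αm), col, x), h1, h2, hx, h3⟩, e, τ, s, ℓ, k, hd⟩
    · rintro m X Y m' X' Y' ⟨e, τ, s, ℓ, k, r⟩ ⟨e', τ', s', ℓ', k', r'⟩ ⟨π, h1, h2, h3, h4⟩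
      exact k.E.size_eq k'.E π (K_mob k k' h1 h2 h3).2.2
    · rintro m X Y X' Y' ⟨e, τ, s, ℓ, k, r⟩ ⟨e', τ', s', ℓ', k', r'⟩
      constructor
      · rintro ⟨π, h1, h2, h3, h4⟩
        obtain ⟨π', he, hs, g1, g2, g3⟩ := K_iso_fwd k k' h1 h2 h3
        exact ⟨π', g1, g2, g3, (k.Rt_iso k' he hs h2 g2 r r').1 h4⟩
      · rintro ⟨π, h1, h2, h3, h4⟩
        obtain ⟨π', he, hs, g1, g2, g3⟩ := K_iso_bwd k k' h1 h2 h3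
        exact ⟨π', g1, g2, g3, (k.Rt_iso k' he hs g2 h2 r r').2 h4⟩
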